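/- There exist absolute constants c > 0 and C > 0 such that for all real x ≥ 2, |π(x) − li x| ≤ C · x · exp(−c·√(log x)), where π(x) is the number of primes not exceeding x. -/

import Mathlib

/-- The number of primes `p ≤ x`, for real `x`. -/
noncomputable def primePi (x : ℝ) : ℕ := {p : ℕ | p.Prime ∧ (p : ℝ) ≤ x}.ncard

/-- The logarithmic integral `li x = ∫₂ˣ dt / log t`. -/
noncomputable def li (x : ℝ) : ℝ := ∫ t in (2:ℝ)..x, 1 / Real.log t

open Complex Metric

/-- If `h` is holomorphic without zeros on a disc of radius `R` about `c`, and `‖h‖` is at most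
`exp M * ‖h c‖` there, then the logarithmic derivative is `O(M / R)` on the disc of half the
radius. -/
lemma norm_logDeriv_le_of_ne_zero {h : ℂ → ℂ} {c z : ℂ} {R M : ℝ} (hR : 0 < R) (hM : 0 < M)
    (hd : DifferentiableOn ℂ h (ball c R)) (h0 : ∀ w ∈ ball c R, h w ≠ 0)
    (hb : ∀ w ∈ ball c R, ‖h w‖ ≤ Real.exp M * ‖h c‖) (hz : z ∈ closedBall c (R / 2)) :
    ‖logDeriv h z‖ ≤ 24 * M / R := by
  have hc : c ∈ ball c R := mem_ball_self hR
  have hdd : DifferentiableOn ℂ (logDeriv h) (ball c R) :=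
    (hd.deriv isOpen_ball).div hd h0
  obtain ⟨G, hG⟩ := hdd.isExactOn_ball
  set F : ℂ → ℂ := fun w => G w - G c with hF
  have hFd : ∀ w ∈ ball c R, HasDerivAt F (logDeriv h w) w := fun w hw => (hG w hw).sub_const _
  have hFc : F c = 0 := by simp [hF]
  have hexp : ∀ w ∈ ball c R, h w * exp (-F w) = h c := by
    have hder : ∀ w ∈ ball c R, HasDerivAt (fun w => h w * exp (-F w)) 0 w := by
      intro w hw
      have h1 : HasDerivAt h (deriv h w) w :=
        (hd.differentiableAt (isOpen_ball.mem_nhds hw)).hasDerivAt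
      refine (h1.mul ((hFd w hw).neg.cexp)).congr_deriv ?_
      rw [logDeriv_apply]
      field_simp [h0 w hw]
      ring
    intro w hw
    have := isOpen_ball.is_const_of_deriv_eq_zero (convex_ball c R).isPreconnected
      (fun w hw => (hder w hw).differentiableAt.differentiableWithinAt)
      (fun w hw => (hder w hw).deriv) hw hc
    simpa [hFc] using this
  have hre : ∀ w ∈ ball c R, (F w).re ≤ M := by
    intro w hw
    have h1 : ‖h w‖ = Real.exp (F w).re * ‖h c‖ := by
      rw [← hexp w hw, norm_mul, norm_exp, neg_re, mul_left_comm, ← Real.exp_add]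
      simp
    have h2 := hb w hw
    rw [h1] at h2
    exact Real.exp_le_exp.1 (le_of_mul_le_mul_right h2 (norm_pos_iff.2 (h0 c hc)))
  have hbound : ∀ w ∈ closedBall c (3 * R / 4), ‖F w‖ ≤ 6 * M := by
    intro w hw
    have hw' : ‖w - c‖ ≤ 3 * R / 4 := by simpa [dist_eq_norm] using hw
    have hmaps : ∀ u ∈ ball (0 : ℂ) R, u + c ∈ ball c R := by
      intro u hu; simpa [dist_eq_norm] using hu
    have := borelCaratheodory_zero (f := fun u => F (u + c)) (z := w - c) hM
      (fun u hu => ((hFd _ (hmaps u hu)).comp_add_const u c).differentiableAt.differentiableWithinAt)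
      (fun u hu => hre _ (hmaps u hu)) hR (by simpa using by linarith) (by simp [hFc])
    simp only [sub_add_cancel] at this
    refine this.trans ?_
    rw [div_le_iff₀ (by linarith)]
    nlinarith
  have hzball : closedBall z (R / 4) ⊆ closedBall c (3 * R / 4) := by
    apply closedBall_subset_closedBall'
    have : dist z c ≤ R / 2 := hz
    linarith
  have hsub : closedBall c (3 * R / 4) ⊆ ball c R := closedBall_subset_ball (by linarith)
  have hzR : z ∈ ball c R := hsub (hzball (mem_closedBall_self (by linarith)))
  rw [← (hFd z hzR).deriv]
  have hdc : DiffContOnCl ℂ F (ball z (R / 4)) := by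
    apply DifferentiableOn.diffContOnCl
    rw [closure_ball _ (by linarith)]
    exact fun w hw => (hFd w (hsub (hzball hw))).differentiableAt.differentiableWithinAt
  refine (norm_deriv_le_of_forall_mem_sphere_norm_le (C := 6 * M) (by linarith) hdc
    fun w hw => hbound w (hzball (sphere_subset_closedBall hw))).trans (le_of_eq ?_)
  field_simp
  norm_num

/-- Division of an entire function by the Blaschke factor of one of its zeros. -/
lemma exists_div_blaschke {f : ℂ → ℂ} {R B : ℝ} {ρ : ℂ} (hf : Differentiable ℂ f) (hρ : f ρ = 0)
    (hρR : ‖ρ‖ ≤ R / 2) (hR : 0 < R) (h0 : f 0 ≠ 0) (hB : ∀ z ∈ closedBall 0 R, ‖f z‖ ≤ B) :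
    ∃ g : ℂ → ℂ, Differentiable ℂ g ∧ (∀ z ∈ closedBall 0 R, ‖g z‖ ≤ B) ∧ 2 * ‖f 0‖ ≤ ‖g 0‖ ∧
      (∀ z ∈ closedBall 0 (R / 2), g z = 0 → f z = 0) ∧
      logDeriv f 0 = logDeriv g 0 + (starRingEnd ℂ ρ / R ^ 2 - 1 / ρ) := by
  have hρ0 : ρ ≠ 0 := by rintro rfl; exact h0 hρ
  have hρn : 0 < ‖ρ‖ := norm_pos_iff.2 hρ0
  have hRC : (R : ℂ) ≠ 0 := by exact_mod_cast hR.ne'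
  have hds : Differentiable ℂ (dslope f ρ) := by
    rw [← differentiableOn_univ, Complex.differentiableOn_dslope Filter.univ_mem]
    exact hf.differentiableOn
  have hfd : ∀ z, f z = (z - ρ) * dslope f ρ z := by
    intro z
    have := sub_smul_dslope f ρ z
    simpa [hρ] using this.symm
  set q : ℂ → ℂ := fun z => ((R : ℂ) ^ 2 - starRingEnd ℂ ρ * z) / R with hq
  have hqd : Differentiable ℂ q := by fun_prop
  have hq0 : q 0 = R := by simp [hq]; field_simp
  have hqne : ∀ z ∈ closedBall (0 : ℂ) R, q z ≠ 0 := by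
    intro z hz h
    have hz' : ‖z‖ ≤ R := by simpa using hz
    rw [hq, div_eq_zero_iff, or_iff_left hRC, sub_eq_zero] at h
    have h2 := congrArg norm h
    simp only [norm_pow, norm_mul, norm_real, Real.norm_eq_abs, abs_of_pos hR,
      RCLike.norm_conj] at h2
    nlinarith
  set g : ℂ → ℂ := fun z => dslope f ρ z * q z with hg
  have hgd : Differentiable ℂ g := hds.mul hqd
  refine ⟨g, hgd, ?_, ?_, ?_, ?_⟩
  · intro z hz
    refine norm_le_of_forall_mem_frontier_norm_le (U := ball 0 R) isBounded_ball
      hgd.diffContOnCl ?_ (by rwa [closure_ball _ hR.ne'])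
    intro w hw
    rw [frontier_ball _ hR.ne'] at hw
    have hwn : ‖w‖ = R := by simpa using hw
    have hwρ : w - ρ ≠ 0 := by
      intro h
      rw [sub_eq_zero] at h
      rw [h] at hwn
      linarith
    have hnq : ‖q w‖ = ‖w - ρ‖ := by
      have h1 : (R : ℂ) ^ 2 = starRingEnd ℂ w * w := by
        rw [mul_comm, mul_conj, normSq_eq_norm_sq, hwn]; simp
      have h2 : q w = starRingEnd ℂ (w - ρ) * w / R := by
        rw [hq, h1, map_sub]; ring
      rw [h2, norm_div, norm_mul, RCLike.norm_conj, hwn, norm_real, Real.norm_eq_abs,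
        abs_of_pos hR]
      field_simp
    calc ‖g w‖ = ‖f w‖ := by rw [hg, hfd w, norm_mul, norm_mul, hnq, mul_comm]
      _ ≤ B := hB w (sphere_subset_closedBall hw)
  · have h1 : ‖f 0‖ = ‖ρ‖ * ‖dslope f ρ 0‖ := by rw [hfd 0]; simp
    have h2 : ‖g 0‖ = ‖dslope f ρ 0‖ * R := by
      simp only [hg]
      rw [norm_mul, hq0, norm_real, Real.norm_eq_abs, abs_of_pos hR]
    rw [h1, h2]
    nlinarith [norm_nonneg (dslope f ρ 0)]
  · intro z hz h
    have : dslope f ρ z = 0 := (mul_eq_zero.1 h).resolve_right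
      (hqne z (closedBall_subset_closedBall (by linarith) hz))
    rw [hfd z, this, mul_zero]
  · have hds0 : dslope f ρ 0 ≠ 0 := by
      intro h; apply h0; rw [hfd 0, h, mul_zero]
    have e1 : logDeriv f 0 = logDeriv (fun z => z - ρ) 0 + logDeriv (dslope f ρ) 0 := by
      rw [← logDeriv_mul (0 : ℂ) (by simpa using hρ0) hds0 (by fun_prop) hds.differentiableAt]
      congr 1
      funext z; exact hfd z
    have e2 : logDeriv g 0 = logDeriv (dslope f ρ) 0 + logDeriv q 0 :=
      logDeriv_mul (0 : ℂ) hds0 (by rw [hq0]; exact hRC) hds.differentiableAt hqd.differentiableAt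
    have e3 : logDeriv (fun z => z - ρ) 0 = -1 / ρ := by
      rw [logDeriv_apply, deriv_sub_const]; simp [neg_div, inv_neg]
    have e4 : logDeriv q 0 = - (starRingEnd ℂ ρ / R ^ 2) := by
      rw [logDeriv_apply, hq0]
      have : HasDerivAt q (-(starRingEnd ℂ ρ * 1) / R) 0 :=
        (((hasDerivAt_id (0 : ℂ)).const_mul (starRingEnd ℂ ρ)).const_sub _).div_const _
      rw [this.deriv]
      field_simp
    rw [e1, e2, e3, e4]; ring

lemma re_blaschke_term_nonneg {ρ : ℂ} {R : ℝ} (hR : 0 < R) (hρR : ‖ρ‖ ≤ R / 2)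
    (hρ : ρ.re ≤ 0) : 0 ≤ (starRingEnd ℂ ρ / R ^ 2 - 1 / ρ).re := by
  rcases eq_or_ne ρ 0 with rfl | h0
  · simp
  have hn : 0 < normSq ρ := normSq_pos.2 h0
  have h1 : (starRingEnd ℂ ρ / R ^ 2 - 1 / ρ).re = -ρ.re * (1 / normSq ρ - 1 / R ^ 2) := by
    rw [sub_re, one_div, inv_re, ← ofReal_pow, div_ofReal_re, conj_re]
    ring
  rw [h1]
  refine mul_nonneg (by linarith) (sub_nonneg.2 (one_div_le_one_div_of_le hn ?_))
  rw [normSq_eq_norm_sq]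
  nlinarith [norm_nonneg ρ]

private lemma re_logDeriv_zero_ge_of_lt_two_pow {R B M : ℝ} (hR : 0 < R) (hM : 0 < M) (n : ℕ) :
    ∀ f : ℂ → ℂ, Differentiable ℂ f → (∀ z ∈ closedBall 0 R, ‖f z‖ ≤ B) → f 0 ≠ 0 →
      (∀ z ∈ closedBall 0 (R / 2), f z = 0 → z.re ≤ 0) → B < 2 ^ n * ‖f 0‖ →
      B ≤ Real.exp M * ‖f 0‖ → -(48 * M / R) ≤ (logDeriv f 0).re := by
  induction n with
  | zero =>
    intro f _ hB _ _ hn _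
    have := hB 0 (by simp [hR.le])
    simp at hn
    linarith
  | succ n ih =>
    intro f hf hB h0 hz hn hM'
    by_cases hex : ∃ ρ ∈ closedBall (0 : ℂ) (R / 2), f ρ = 0
    · obtain ⟨ρ, hρ, hfρ⟩ := hex
      have hρ' : ‖ρ‖ ≤ R / 2 := by simpa using hρ
      obtain ⟨g, hg, hgB, hg0, hgz, hlog⟩ := exists_div_blaschke hf hfρ hρ' hR h0 hB
      have hfp : 0 < ‖f 0‖ := norm_pos_iff.2 h0
      have hg0' : g 0 ≠ 0 := norm_pos_iff.1 (by linarith)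
      have := ih g hg hgB hg0' (fun z hz' h => hz z hz' (hgz z hz' h))
        (hn.trans_le (by rw [pow_succ, mul_assoc]; gcongr))
        (hM'.trans (by gcongr; linarith))
      rw [hlog, add_re]
      linarith [re_blaschke_term_nonneg hR hρ' (hz ρ hρ hfρ)]
    · push Not at hex
      have := norm_logDeriv_le_of_ne_zero (z := 0) (by linarith : 0 < R / 2) hM hf.differentiableOn
        (fun w hw => hex w (ball_subset_closedBall hw))
        (fun w hw => (hB w (closedBall_subset_closedBall (by linarith)
          (ball_subset_closedBall hw))).trans hM') (by simp; linarith)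
      have h2 := (abs_le.1 ((abs_re_le_norm _).trans this)).1
      rwa [show 24 * M / (R / 2) = 48 * M / R by field_simp; norm_num] at h2

/-- Lower bound for the real part of the logarithmic derivative at the centre of a disc, for a
function whose zeros all lie in a half plane bounded by a line through the centre. -/
lemma re_logDeriv_zero_ge {f : ℂ → ℂ} {R B M : ℝ} (hR : 0 < R) (hM : 0 < M)
    (hf : Differentiable ℂ f) (hB : ∀ z ∈ closedBall 0 R, ‖f z‖ ≤ B) (h0 : f 0 ≠ 0)
    (hz : ∀ z ∈ closedBall 0 (R / 2), f z = 0 → z.re ≤ 0) (hM' : B ≤ Real.exp M * ‖f 0‖) :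
    -(48 * M / R) ≤ (logDeriv f 0).re := by
  obtain ⟨n, hn⟩ := pow_unbounded_of_one_lt (B / ‖f 0‖) one_lt_two
  rw [div_lt_iff₀ (norm_pos_iff.2 h0)] at hn
  exact re_logDeriv_zero_ge_of_lt_two_pow hR hM n f hf hB h0 hz hn hM'

/-- A version of `re_logDeriv_zero_ge` which retains the contribution of one real zero. -/
lemma re_logDeriv_zero_ge_of_zero {f : ℂ → ℂ} {R B M δ : ℝ} (hR : 0 < R) (hM : 0 < M)
    (hf : Differentiable ℂ f) (hB : ∀ z ∈ closedBall 0 R, ‖f z‖ ≤ B) (h0 : f 0 ≠ 0)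
    (hz : ∀ z ∈ closedBall 0 (R / 2), f z = 0 → z.re ≤ 0) (hM' : B ≤ Real.exp M * ‖f 0‖)
    (hδ : 0 < δ) (hδR : δ ≤ R / 2) (hfδ : f (-δ : ℝ) = 0) :
    1 / δ - δ / R ^ 2 - 48 * M / R ≤ (logDeriv f 0).re := by
  obtain ⟨g, hg, hgB, hg0, hgz, hlog⟩ := exists_div_blaschke hf hfδ
    (by simpa [abs_of_pos hδ] using hδR) hR h0 hB
  have hfp : 0 < ‖f 0‖ := norm_pos_iff.2 h0
  have := re_logDeriv_zero_ge hR hM hg hgB (norm_pos_iff.1 (by linarith))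
    (fun z hz' h => hz z hz' (hgz z hz' h)) (hM'.trans (by gcongr; linarith))
  have e : (starRingEnd ℂ ((-δ : ℝ) : ℂ) / R ^ 2 - 1 / ((-δ : ℝ) : ℂ)) =
      ((1 / δ - δ / R ^ 2 : ℝ) : ℂ) := by
    rw [conj_ofReal]
    push_cast
    rw [div_neg]; ring
  rw [hlog, add_re, e, ofReal_re]
  linarith

open MeasureTheory Set Filter Topology

/-- The integral `∫₁^∞ {t} t^(-s-1) dt`. -/
noncomputable def fractIntegral (s : ℂ) : ℂ :=
  ∫ t in Ioi (1 : ℝ), ((Int.fract t : ℝ) : ℂ) * (t : ℂ) ^ (-(s + 1))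

lemma differentiableAt_fractIntegral {s : ℂ} (hs : 0 < s.re) :
    DifferentiableAt ℂ fractIntegral s := by
  set φ : ℝ → ℂ := (Ioi (1 : ℝ)).indicator (fun t => ((Int.fract t : ℝ) : ℂ)) with hφ
  have hle : ∀ t, ‖φ t‖ ≤ 1 := by
    intro t
    rw [hφ]
    refine (norm_indicator_le_norm_self _ _).trans ?_
    rw [norm_real, Real.norm_eq_abs, abs_of_nonneg (Int.fract_nonneg t)]
    exact (Int.fract_lt_one t).le
  have hmeas : Measurable φ :=
    (Complex.measurable_ofReal.comp measurable_fract).indicator measurableSet_Ioi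
  have e : fractIntegral = fun s => mellin φ (-s) := by
    funext s
    rw [fractIntegral, mellin]
    have : ∀ t : ℝ, (t : ℂ) ^ (-s - 1) • φ t =
        (Ioi (1 : ℝ)).indicator (fun t => ((Int.fract t : ℝ) : ℂ) * (t : ℂ) ^ (-(s + 1))) t := by
      intro t
      rw [hφ]
      by_cases ht : t ∈ Ioi (1 : ℝ)
      · rw [indicator_of_mem ht, indicator_of_mem ht, smul_eq_mul, mul_comm, neg_add']
      · rw [indicator_of_notMem ht, indicator_of_notMem ht, smul_zero]
    simp_rw [this]
    rw [setIntegral_indicator measurableSet_Ioi, inter_eq_right.2 (Ioi_subset_Ioi zero_le_one)]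
  have hd : DifferentiableAt ℂ (mellin φ) (-s) := by
    refine mellin_differentiableAt_of_isBigO_rpow (a := 0) (b := -s.re - 1) ?_ ?_ (by simpa) ?_
      (by simp)
    · refine LocallyIntegrable.locallyIntegrableOn ?_ _
      exact (locallyIntegrable_const (1 : ℝ)).mono hmeas.aestronglyMeasurable
        (Eventually.of_forall fun t => by simpa using hle t)
    · simp only [neg_zero, Real.rpow_zero]
      exact Asymptotics.isBigO_of_le _ fun t => by simpa using hle t
    · refine (Asymptotics.isBigO_zero _ _).congr' ?_ EventuallyEq.rfl
      filter_upwards [mem_nhdsWithin_of_mem_nhds (Iio_mem_nhds (zero_lt_one' ℝ))] with t ht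
      rw [hφ, indicator_of_notMem]
      simpa using ht.le
  rw [e]
  exact hd.comp s differentiableAt_id.neg

lemma norm_fractIntegral_le {s : ℂ} (hs : 0 < s.re) : ‖fractIntegral s‖ ≤ 1 / s.re := by
  have hi : IntegrableOn (fun t : ℝ => t ^ (-(s.re + 1))) (Ioi 1) :=
    integrableOn_Ioi_rpow_of_lt (by linarith) one_pos
  refine (norm_integral_le_of_norm_le hi ?_).trans (le_of_eq ?_)
  · filter_upwards [ae_restrict_mem measurableSet_Ioi] with t ht
    have ht0 : (0 : ℝ) < t := one_pos.trans ht
    rw [norm_mul, norm_cpow_eq_rpow_re_of_pos ht0, norm_real, Real.norm_eq_abs,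
      abs_of_nonneg (Int.fract_nonneg t)]
    simpa using mul_le_of_le_one_left (Real.rpow_nonneg ht0.le _) (Int.fract_lt_one t).le
  · rw [integral_Ioi_rpow_of_lt (by linarith) one_pos, Real.one_rpow]
    rw [show -(s.re + 1) + 1 = -s.re by ring, neg_div_neg_eq]

lemma riemannZeta₁_eq_of_one_lt_re {s : ℂ} (hs : 1 < s.re) :
    riemannZeta₁ s = s - s * (s - 1) * fractIntegral s := by
  have hs1 : s ≠ 1 := by rintro rfl; simp at hs
  have hs1' : s - 1 ≠ 0 := sub_ne_zero.2 hs1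
  have h1 : riemannZeta s = s * ∫ t in Ioi (1 : ℝ), (⌊t⌋₊ : ℂ) * (t : ℂ) ^ (-(s + 1)) := by
    rw [← LSeries_one_eq_riemannZeta hs, LSeries_eq_mul_integral' 1 zero_le_one hs]
    · simp
    · simpa using Asymptotics.isBigO_refl _ _
  have h2 : ∫ t in Ioi (1 : ℝ), (t : ℂ) ^ (-s) = 1 / (s - 1) := by
    rw [integral_Ioi_cpow_of_lt (by simpa using hs) one_pos, ofReal_one, one_cpow,
      ← neg_div_neg_eq, neg_neg]
    congr 1; ring
  have h3 : ∫ t in Ioi (1 : ℝ), (⌊t⌋₊ : ℂ) * (t : ℂ) ^ (-(s + 1)) =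
      1 / (s - 1) - fractIntegral s := by
    rw [← h2, fractIntegral, ← integral_sub]
    · refine setIntegral_congr_fun measurableSet_Ioi fun t ht => ?_
      have ht0 : (0 : ℝ) < t := one_pos.trans ht
      have ht1 : (t : ℂ) ≠ 0 := by exact_mod_cast ht0.ne'
      have e1 : (t : ℂ) ^ (-s) = t * (t : ℂ) ^ (-(s + 1)) := by
        rw [neg_add, cpow_add _ _ ht1, cpow_neg_one]; field_simp
      have e2 : ((⌊t⌋₊ : ℝ) : ℂ) = (t : ℂ) - (Int.fract t : ℝ) := by
        rw [natCast_floor_eq_intCast_floor ht0.le, Int.fract]; push_cast; ring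
      rw [e1, ← sub_mul, ← e2, ofReal_natCast]
    · exact integrableOn_Ioi_cpow_of_lt (by simpa using hs) one_pos
    · have hi : IntegrableOn (fun t : ℝ => t ^ (-(s.re + 1))) (Ioi 1) :=
        integrableOn_Ioi_rpow_of_lt (by linarith) one_pos
      refine hi.mono' ?_ ?_
      · refine AEStronglyMeasurable.mul ?_ ?_
        · exact (Complex.measurable_ofReal.comp measurable_fract).aestronglyMeasurable
        · refine ContinuousOn.aestronglyMeasurable ?_ measurableSet_Ioi
          intro t ht
          exact (continuousAt_ofReal_cpow_const _ _
            (Or.inr (one_pos.trans ht).ne')).continuousWithinAt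
      · filter_upwards [ae_restrict_mem measurableSet_Ioi] with t ht
        have ht0 : (0 : ℝ) < t := one_pos.trans ht
        rw [norm_mul, norm_cpow_eq_rpow_re_of_pos ht0, norm_real, Real.norm_eq_abs,
          abs_of_nonneg (Int.fract_nonneg t)]
        simpa using mul_le_of_le_one_left (Real.rpow_nonneg ht0.le _) (Int.fract_lt_one t).le
  have h4 := riemannZeta_eq_inv_sub_mul hs1
  rw [h1, h3, eq_comm, inv_mul_eq_iff_eq_mul₀ hs1'] at h4
  rw [h4]
  field_simp

lemma riemannZeta₁_eq {s : ℂ} (hs : 0 < s.re) :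
    riemannZeta₁ s = s - s * (s - 1) * fractIntegral s := by
  set U : Set ℂ := {s | 0 < s.re} with hU
  have hUo : IsOpen U := isOpen_lt continuous_const continuous_re
  have hUc : IsPreconnected U := (convex_halfSpace_re_gt 0).isPreconnected
  have ha : AnalyticOnNhd ℂ riemannZeta₁ U :=
    differentiable_riemannZeta₁.differentiableOn.analyticOnNhd hUo
  have hb : AnalyticOnNhd ℂ (fun s => s - s * (s - 1) * fractIntegral s) U := by
    refine DifferentiableOn.analyticOnNhd (fun z hz => ?_) hUo
    have := differentiableAt_fractIntegral hz
    exact DifferentiableAt.differentiableWithinAt (by fun_prop)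
  refine ha.eqOn_of_preconnected_of_eventuallyEq hb hUc (z₀ := 2) (by simp [hU]) ?_ hs
  have : {z : ℂ | 1 < z.re} ∈ 𝓝 (2 : ℂ) :=
    (isOpen_lt continuous_const continuous_re).mem_nhds (by simp)
  filter_upwards [this] with z hz using riemannZeta₁_eq_of_one_lt_re hz

lemma norm_riemannZeta₁_le {s : ℂ} (hs : 1 / 2 ≤ s.re) :
    ‖riemannZeta₁ s‖ ≤ 2 * (‖s‖ + 1) ^ 2 := by
  have hs0 : 0 < s.re := by linarith
  rw [riemannZeta₁_eq hs0]
  have h1 : ‖fractIntegral s‖ ≤ 2 := (norm_fractIntegral_le hs0).trans (by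
    rw [div_le_iff₀ hs0]; linarith)
  have h2 : ‖s - 1‖ ≤ ‖s‖ + 1 := (norm_sub_le _ _).trans (by simp)
  calc ‖s - s * (s - 1) * fractIntegral s‖
      ≤ ‖s‖ + ‖s‖ * ‖s - 1‖ * ‖fractIntegral s‖ := by
        refine (norm_sub_le _ _).trans ?_
        rw [norm_mul, norm_mul]
    _ ≤ ‖s‖ + ‖s‖ * (‖s‖ + 1) * 2 := by gcongr
    _ ≤ _ := by nlinarith [norm_nonneg s]

section LSeriesNotation

open ArithmeticFunction LSeries
open scoped LSeries.notation ArithmeticFunction.Moebius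

lemma tsum_norm_term_one_eq {s : ℂ} (hs : 1 < s.re) :
    ∑' n, ‖term 1 s n‖ = ‖riemannZeta (s.re : ℂ)‖ := by
  have h : HasSum (fun n => term 1 (s.re : ℂ) n) (riemannZeta (s.re : ℂ)) :=
    LSeriesHasSum_one (by simpa using hs)
  have e : ∀ n, term 1 (s.re : ℂ) n = ((‖term 1 s n‖ : ℝ) : ℂ) := by
    intro n
    rcases eq_or_ne n 0 with rfl | hn
    · simp
    · rw [norm_term_eq, if_neg hn, term_of_ne_zero hn]
      have : ((n : ℝ) : ℂ) ^ (s.re : ℂ) = (((n : ℝ) ^ s.re : ℝ) : ℂ) := by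
        rw [ofReal_cpow (Nat.cast_nonneg n)]
      rw [ofReal_natCast] at this
      rw [this]; simp
  simp_rw [e] at h
  rw [← h.tsum_eq, ← ofReal_tsum, norm_real, Real.norm_of_nonneg]
  exact tsum_nonneg fun n => norm_nonneg _

lemma inv_le_norm_riemannZeta {s : ℂ} (hs : 1 < s.re) :
    ‖riemannZeta (s.re : ℂ)‖⁻¹ ≤ ‖riemannZeta s‖ := by
  have h1 : ‖L ↗μ s‖ ≤ ‖riemannZeta (s.re : ℂ)‖ := by
    rw [← tsum_norm_term_one_eq hs]
    have hsum : Summable fun n => ‖term 1 s n‖ := (LSeriesHasSum_one hs).summable.norm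
    refine tsum_of_norm_bounded hsum.hasSum fun n => norm_term_le s ?_
    rw [Pi.one_apply, norm_one, norm_intCast]
    exact_mod_cast abs_moebius_le_one
  have h2 : ‖riemannZeta s‖ * ‖L ↗μ s‖ = 1 := by
    rw [← norm_mul, ← LSeries_one_eq_riemannZeta hs, LSeries_one_mul_Lseries_moebius hs, norm_one]
  have h3 : 0 < ‖L ↗μ s‖ := by
    refine (norm_nonneg _).lt_of_ne' fun h => ?_
    rw [h, mul_zero] at h2; exact zero_ne_one h2
  rw [eq_inv_of_mul_eq_one_left h2]
  exact inv_anti₀ h3 h1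

lemma norm_riemannZeta₁_ge {s : ℂ} (hs : 1 < s.re) (hs2 : s.re ≤ 2) :
    (s.re - 1) ^ 2 / 18 ≤ ‖riemannZeta₁ s‖ := by
  have hpos : 0 < s.re - 1 := by linarith
  have aux : ∀ z : ℂ, 1 < z.re → ‖riemannZeta₁ z‖ = ‖z - 1‖ * ‖riemannZeta z‖ := by
    intro z hz
    have hz1 : z ≠ 1 := by rintro rfl; simp at hz
    rw [riemannZeta_eq_inv_sub_mul hz1, ← norm_mul, mul_inv_cancel_left₀ (sub_ne_zero.2 hz1)]
  have h1 : (s.re - 1) * ‖riemannZeta (s.re : ℂ)‖ ≤ 18 := by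
    have h := aux (s.re : ℂ) (by simpa using hs)
    have hn : ‖(s.re : ℂ) - 1‖ = s.re - 1 := by
      rw [← ofReal_one, ← ofReal_sub, norm_real, Real.norm_of_nonneg hpos.le]
    rw [hn] at h
    rw [← h]
    refine (norm_riemannZeta₁_le (by simp; linarith)).trans ?_
    rw [norm_real, Real.norm_of_nonneg (by linarith)]
    nlinarith
  have h0 : 0 < ‖riemannZeta (s.re : ℂ)‖ :=
    norm_pos_iff.2 (riemannZeta_ne_zero_of_one_lt_re (by simpa using hs))
  have h2 : (s.re - 1) / 18 ≤ ‖riemannZeta s‖ := by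
    refine le_trans ?_ (inv_le_norm_riemannZeta hs)
    rw [le_inv_comm₀ (by positivity) h0, inv_div, le_div_iff₀ hpos]
    linarith
  have h3 : s.re - 1 ≤ ‖s - 1‖ := by
    simpa using re_le_norm (s - 1)
  rw [aux s hs]
  calc (s.re - 1) ^ 2 / 18 = (s.re - 1) * ((s.re - 1) / 18) := by ring
    _ ≤ _ := by gcongr

lemma riemannZeta₁_ne_zero_of_one_le_re {s : ℂ} (hs : 1 ≤ s.re) : riemannZeta₁ s ≠ 0 := by
  rcases eq_or_ne s 1 with rfl | h1
  · rw [riemannZeta₁_one]; exact one_ne_zero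
  · intro h
    refine riemannZeta_ne_zero_of_one_le_re hs ?_
    rw [riemannZeta_eq_inv_sub_mul h1, h, mul_zero]

lemma logDeriv_riemannZeta₁ {s : ℂ} (hs : 1 < s.re) :
    logDeriv riemannZeta₁ s = 1 / (s - 1) - L ↗Λ s := by
  have hs1 : s ≠ 1 := by rintro rfl; simp at hs
  have hs1' : s - 1 ≠ 0 := sub_ne_zero.2 hs1
  have hz := riemannZeta_ne_zero_of_one_lt_re hs
  have e : riemannZeta₁ =ᶠ[𝓝 s] fun z => (z - 1) * riemannZeta z := by
    filter_upwards [isOpen_ne.mem_nhds hs1] with z hz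
    rw [riemannZeta_eq_inv_sub_mul hz, mul_inv_cancel_left₀ (sub_ne_zero.2 hz)]
  rw [LSeries_vonMangoldt_eq_deriv_riemannZeta_div hs, logDeriv_apply, e.deriv_eq, e.eq_of_nhds,
    deriv_fun_mul (by fun_prop) (differentiableAt_riemannZeta hs1), deriv_sub_const, deriv_id'']
  field_simp
  ring

lemma three_four_one {σ : ℝ} (hσ : 1 < σ) (t : ℝ) :
    0 ≤ 3 * (L ↗Λ (σ : ℂ)).re + 4 * (L ↗Λ (σ + t * I)).re + (L ↗Λ (σ + 2 * t * I)).re := by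
  have key : ∀ s : ℂ, 1 < s.re → HasSum (fun n => (term ↗Λ s n).re) (L ↗Λ s).re := fun s hs =>
    hasSum_re (LSeriesSummable_vonMangoldt hs).LSeriesHasSum
  have h := (((key (σ : ℂ) (by simpa)).mul_left 3).add
    ((key (σ + t * I) (by simpa)).mul_left 4)).add (key (σ + 2 * t * I) (by simpa))
  refine h.nonneg fun n => ?_
  rcases eq_or_ne n 0 with rfl | hn
  · simp
  have hn0 : (n : ℂ) ≠ 0 := by exact_mod_cast hn
  set z : ℂ := (n : ℂ) ^ (-(t * I)) with hz
  set a : ℝ := Λ n * (n : ℝ) ^ (-σ) with ha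
  have ha0 : 0 ≤ a := mul_nonneg vonMangoldt_nonneg (Real.rpow_nonneg (Nat.cast_nonneg n) _)
  have hz1 : ‖z‖ = 1 := by
    rw [hz, norm_natCast_cpow_of_pos (Nat.pos_of_ne_zero hn)]; simp
  have hσn : (n : ℂ) ^ (-(σ : ℂ)) = (((n : ℝ) ^ (-σ) : ℝ) : ℂ) := by
    rw [ofReal_cpow (Nat.cast_nonneg n)]; simp
  have e0 : term ↗Λ (σ : ℂ) n = a := by
    rw [term_of_ne_zero hn, div_eq_mul_inv, ← cpow_neg, hσn, ha]; push_cast; rfl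
  have e1 : term ↗Λ (σ + t * I) n = a * z := by
    rw [term_of_ne_zero hn, div_eq_mul_inv, ← cpow_neg, neg_add, cpow_add _ _ hn0, hσn, ha]
    push_cast; ring
  have e2 : term ↗Λ (σ + 2 * t * I) n = a * z ^ 2 := by
    rw [term_of_ne_zero hn, div_eq_mul_inv, ← cpow_neg, neg_add,
      show -(2 * t * I : ℂ) = -(t * I) + -(t * I) by ring, cpow_add _ _ hn0, cpow_add _ _ hn0,
      hσn, ha]
    push_cast; ring
  have hsq : z.re ^ 2 + z.im ^ 2 = 1 := by
    have := Complex.sq_norm z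
    rw [hz1, normSq_apply] at this
    nlinarith
  rw [e0, e1, e2, re_ofReal_mul, re_ofReal_mul, ofReal_re]
  have : (z ^ 2).re = z.re ^ 2 - z.im ^ 2 := by rw [sq, mul_re]; ring
  rw [this]
  have : 0 ≤ a * (2 * (1 + z.re) ^ 2) := by positivity
  nlinarith

end LSeriesNotation

open scoped ArithmeticFunction

/-- The logarithmic size `log (|t| + 3)` of a height `t`. -/
noncomputable def logHeight (t : ℝ) : ℝ := Real.log (|t| + 3)

lemma exp_logHeight (t : ℝ) : Real.exp (logHeight t) = |t| + 3 :=
  Real.exp_log (by positivity)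

lemma one_le_logHeight (t : ℝ) : 1 ≤ logHeight t := by
  rw [logHeight, Real.le_log_iff_exp_le (by positivity)]
  linarith [Real.exp_one_lt_d9, abs_nonneg t]

lemma logHeight_le_two_mul {t u : ℝ} (h : |u| ≤ 2 * |t| + 1) : logHeight u ≤ 2 * logHeight t := by
  have : 2 * logHeight t = Real.log ((|t| + 3) ^ 2) := by rw [Real.log_pow]; rfl
  rw [this]
  exact Real.log_le_log (by positivity) (by nlinarith [abs_nonneg t])

lemma logHeight_zero_le (t : ℝ) : logHeight 0 ≤ logHeight t :=
  Real.log_le_log (by positivity) (by simp)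

lemma differentiable_riemannZeta₁_add (s : ℂ) : Differentiable ℂ fun z => riemannZeta₁ (s + z) :=
  fun _ => (differentiable_riemannZeta₁ _).comp _ (by fun_prop)

lemma logDeriv_comp_const_add (f : ℂ → ℂ) (s : ℂ) :
    logDeriv (fun z => f (s + z)) 0 = logDeriv f s := by
  simp [logDeriv_apply, deriv_comp_const_add]

lemma norm_riemannZeta₁_le_of_mem {δ t : ℝ} (hδ : 0 < δ) (hδ' : δ ≤ 1 / 2) {z : ℂ}
    (hz : z ∈ closedBall (0 : ℂ) (1 / 2)) :
    ‖riemannZeta₁ (1 + δ + t * I + z)‖ ≤ 2 * (|t| + 3) ^ 2 := by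
  have hz' : ‖z‖ ≤ 1 / 2 := by simpa using hz
  have hre : |z.re| ≤ 1 / 2 := (abs_re_le_norm z).trans hz'
  refine (norm_riemannZeta₁_le ?_).trans ?_
  · simp; linarith [(abs_le.1 hre).1]
  · have h1 : ‖(1 + δ + t * I + z : ℂ)‖ ≤ 1 + δ + |t| + ‖z‖ := by
      refine (norm_add_le _ _).trans (add_le_add_left ((norm_add_le _ _).trans ?_) _)
      refine add_le_add ((norm_add_le _ _).trans ?_) ?_
      · simp [abs_of_pos hδ]
      · simp
    have h2 : ‖(1 + δ + t * I + z : ℂ)‖ + 1 ≤ |t| + 3 := by linarith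
    gcongr

lemma re_logDeriv_riemannZeta₁_aux {δ t : ℝ} (hδ : 0 < δ) (hδ' : δ ≤ 1 / 2) :
    2 * (|t| + 3) ^ 2 ≤ Real.exp (6 * logHeight t + 2 * Real.log (1 / δ)) *
      ‖riemannZeta₁ (1 + δ + t * I + 0)‖ ∧
    48 * (6 * logHeight t + 2 * Real.log (1 / δ)) / (1 / 2) ≤ 1 / (20 * δ) + 2400 * logHeight t := by
  constructor
  · have h := norm_riemannZeta₁_ge (s := 1 + δ + t * I + 0) (by simpa) (by simp; linarith)
    have e : (1 + δ + t * I + 0 : ℂ).re - 1 = δ := by simp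
    rw [e] at h
    have h3 : Real.exp (6 * logHeight t + 2 * Real.log (1 / δ)) = (|t| + 3) ^ 6 * (1 / δ) ^ 2 := by
      rw [Real.exp_add, ← exp_logHeight t, ← Real.exp_nat_mul]
      rw [show 2 * Real.log (1 / δ) = (2 : ℕ) * Real.log (1 / δ) by norm_num, Real.exp_nat_mul,
        Real.exp_log (show 0 < 1 / δ by positivity)]
      norm_num
    rw [h3]
    have h4 : (3 : ℝ) ^ 4 ≤ (|t| + 3) ^ 4 := by gcongr; linarith [abs_nonneg t]
    calc 2 * (|t| + 3) ^ 2 ≤ (|t| + 3) ^ 4 / 18 * (|t| + 3) ^ 2 := by gcongr; linarith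
      _ = (|t| + 3) ^ 6 * (1 / δ) ^ 2 * (δ ^ 2 / 18) := by field_simp
      _ ≤ _ := by gcongr
  · have h1 : Real.log (1 / δ) ≤ 1 / (3840 * δ) + 9 := by
      have e : Real.log (1 / δ) = Real.log (1 / (3840 * δ)) + Real.log 3840 := by
        rw [← Real.log_mul (by positivity) (by norm_num)]; congr 1; field_simp
      have e1 := Real.log_le_sub_one_of_pos (show 0 < 1 / (3840 * δ) by positivity)
      have e2 : Real.log 3840 ≤ 9 := by
        rw [Real.log_le_iff_le_exp (by norm_num), show (9 : ℝ) = (9 : ℕ) * 1 by norm_num,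
          Real.exp_nat_mul]
        calc (3840 : ℝ) ≤ 2.7 ^ 9 := by norm_num
          _ ≤ _ := by gcongr; linarith [Real.exp_one_gt_d9]
      linarith
    have h2 := one_le_logHeight t
    have e3 : 192 * (1 / (3840 * δ)) = 1 / (20 * δ) := by field_simp; norm_num
    linarith

lemma re_logDeriv_riemannZeta₁_ge {δ : ℝ} (hδ : 0 < δ) (hδ' : δ ≤ 1 / 2) (t : ℝ) :
    -(1 / (20 * δ) + 2400 * logHeight t) ≤ (logDeriv riemannZeta₁ (1 + δ + t * I)).re := by
  obtain ⟨hM1, hM2⟩ := re_logDeriv_riemannZeta₁_aux (t := t) hδ hδ'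
  have hlog : 0 ≤ Real.log (1 / δ) := Real.log_nonneg (by rw [le_div_iff₀ hδ]; linarith)
  have h := re_logDeriv_zero_ge (R := 1 / 2) (M := 6 * logHeight t + 2 * Real.log (1 / δ))
    (by norm_num) (by linarith [one_le_logHeight t])
    (differentiable_riemannZeta₁_add (1 + δ + t * I))
    (fun z hz => norm_riemannZeta₁_le_of_mem hδ hδ' hz)
    (riemannZeta₁_ne_zero_of_one_le_re (by simp [hδ.le])) (fun z _ hz0 => ?_) hM1
  · rw [logDeriv_comp_const_add] at h
    linarith
  · by_contra! hz
    exact riemannZeta₁_ne_zero_of_one_le_re (by simp; linarith) hz0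

lemma re_logDeriv_riemannZeta₁_ge_of_zero {δ β t : ℝ} (hδ : 0 < δ) (hβ : β < 1)
    (hδβ : 1 + δ - β ≤ 1 / 4) (h0 : riemannZeta₁ (β + t * I) = 0) :
    1 / (1 + δ - β) - (1 / (20 * δ) + 2401 * logHeight t) ≤
      (logDeriv riemannZeta₁ (1 + δ + t * I)).re := by
  have hδ' : δ ≤ 1 / 2 := by linarith
  obtain ⟨hM1, hM2⟩ := re_logDeriv_riemannZeta₁_aux (t := t) hδ hδ'
  have hlog : 0 ≤ Real.log (1 / δ) := Real.log_nonneg (by rw [le_div_iff₀ hδ]; linarith)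
  have h := re_logDeriv_zero_ge_of_zero (R := 1 / 2) (M := 6 * logHeight t + 2 * Real.log (1 / δ))
    (δ := 1 + δ - β)
    (by norm_num) (by linarith [one_le_logHeight t])
    (differentiable_riemannZeta₁_add (1 + δ + t * I))
    (fun z hz => norm_riemannZeta₁_le_of_mem hδ hδ' hz)
    (riemannZeta₁_ne_zero_of_one_le_re (by simp [hδ.le])) (fun z _ hz0 => ?_) hM1
    (by linarith) (by linarith) ?_
  · rw [logDeriv_comp_const_add] at h
    have h4 : (1 + δ - β) / (1 / 2) ^ 2 ≤ 1 := by norm_num; linarith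
    linarith [one_le_logHeight t]
  · by_contra! hz
    exact riemannZeta₁_ne_zero_of_one_le_re (by simp; linarith) hz0
  · rw [← h0]; congr 1; push_cast; ring

lemma zero_free_of_one_le_abs {β t : ℝ} (ht : 1 ≤ |t|) (hβ : 1 - 1 / (10 ^ 6 * logHeight t) < β) :
    riemannZeta₁ (β + t * I) ≠ 0 := by
  intro h0
  set L := logHeight t with hL
  have hL1 : 1 ≤ L := one_le_logHeight t
  have hβ1 : β < 1 := by
    by_contra! h
    exact riemannZeta₁_ne_zero_of_one_le_re (by simpa) h0
  set δ : ℝ := 1 / (110000 * L) with hδ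
  have hδ0 : 0 < δ := by positivity
  have hδ1 : δ ≤ 1 / 110000 := by rw [hδ]; gcongr; linarith
  have hη : 1 / (10 ^ 6 * L) ≤ 1 / 10 ^ 6 := by gcongr; linarith
  have hη' : 1 / (10 ^ 6 * L) ≤ δ * (11 / 100) := le_of_eq (by rw [hδ]; field_simp; norm_num)
  have h341 := three_four_one (show 1 < 1 + δ by linarith) t
  have e : ∀ s : ℂ, 1 < s.re → (LSeries (fun n => (Λ n : ℂ)) s).re = (1 / (s - 1)).re - (logDeriv riemannZeta₁ s).re := by
    intro s hs
    rw [logDeriv_riemannZeta₁ hs, sub_re]; ring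
  have hre : ∀ u : ℝ, (1 / ((1 + δ : ℝ) + u * I - 1 : ℂ)).re = δ / (δ ^ 2 + u ^ 2) := by
    intro u
    rw [show ((1 + δ : ℝ) + u * I - 1 : ℂ) = δ + u * I by push_cast; ring, one_div, inv_re,
      normSq_add_mul_I]
    simp
  have hre' : ∀ u : ℝ, 1 ≤ |u| → δ / (δ ^ 2 + u ^ 2) ≤ 1 := by
    intro u hu
    rw [div_le_one (by positivity)]
    nlinarith [sq_abs u]
  rw [e _ (by simpa), e _ (by simpa), e _ (by simpa), hre] at h341
  have hre0 := hre 0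
  have hre2 := hre (2 * t)
  have b0 := re_logDeriv_riemannZeta₁_ge hδ0 (by linarith) 0
  have b1 := re_logDeriv_riemannZeta₁_ge_of_zero hδ0 hβ1 (by linarith) h0
  have b2 := re_logDeriv_riemannZeta₁_ge hδ0 (by linarith) (2 * t)
  have c1 := hre' t ht
  have c2 := hre' (2 * t) (by rw [abs_mul]; norm_num; linarith)
  push_cast at h341 hre0 hre2 b0 b1 b2
  rw [zero_mul, add_zero] at hre0 b0
  rw [hre0, hre2] at h341
  have d0 : δ / (δ ^ 2 + 0 ^ 2) = 110000 * L := by rw [hδ]; field_simp; ring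
  have d1 : 1 / (20 * δ) = 5500 * L := by rw [hδ]; field_simp; norm_num
  have d2 : 1 / (1 + δ - β) ≥ 1 / (δ * (111 / 100)) := by
    refine one_div_le_one_div_of_le (by linarith) (by linarith)
  have d3 : 1 / (δ * (111 / 100)) = 110000 * L * (100 / 111) := by rw [hδ]; field_simp
  have l0 := logHeight_zero_le t
  have l2 : logHeight (2 * t) ≤ 2 * logHeight t :=
    logHeight_le_two_mul (by rw [abs_mul]; norm_num)
  rw [d0] at h341
  rw [d1] at b0 b1 b2
  rw [← hL] at *
  linarith

lemma exists_zero_free : ∃ η : ℝ, 0 < η ∧ η ≤ 1 / 8 ∧ ∀ s : ℂ, 1 - η / logHeight s.im ≤ s.re →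
    riemannZeta₁ s ≠ 0 := by
  set K : Set ℂ := (fun t : ℝ => 1 + t * I) '' Icc (-1) 1 with hK
  have hKc : IsCompact K := isCompact_Icc.image (by fun_prop)
  have hU : IsOpen {s : ℂ | riemannZeta₁ s ≠ 0} :=
    isOpen_ne_fun differentiable_riemannZeta₁.continuous continuous_const
  have hKU : K ⊆ {s : ℂ | riemannZeta₁ s ≠ 0} := by
    rintro _ ⟨t, -, rfl⟩
    exact riemannZeta₁_ne_zero_of_one_le_re (by simp)
  obtain ⟨δ, hδ, h⟩ := hKc.exists_thickening_subset_open hU hKU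
  refine ⟨min (δ / 2) (1 / (2 * 10 ^ 6)), by positivity,
    (min_le_right _ _).trans (by norm_num), fun s hs => ?_⟩
  have hL := one_le_logHeight s.im
  rcases le_or_gt 1 |s.im| with h1 | h1
  · rw [← re_add_im s]
    refine zero_free_of_one_le_abs h1 (lt_of_lt_of_le ?_ hs)
    have : min (δ / 2) (1 / (2 * 10 ^ 6)) / logHeight s.im ≤
        1 / (2 * 10 ^ 6) / logHeight s.im := by gcongr; exact min_le_right _ _
    refine sub_lt_sub_left (this.trans_lt ?_) _
    rw [div_div]
    refine one_div_lt_one_div_of_lt (by positivity) (by nlinarith)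
  · rcases le_or_gt 1 s.re with h2 | h2
    · exact riemannZeta₁_ne_zero_of_one_le_re h2
    refine h (mem_thickening_iff.2 ⟨1 + s.im * I, ⟨s.im, abs_le.1 h1.le, rfl⟩, ?_⟩)
    have : min (δ / 2) (1 / (2 * 10 ^ 6)) / logHeight s.im ≤ δ / 2 :=
      (div_le_self (by positivity) hL).trans (min_le_left _ _)
    rw [dist_eq]
    have e : s - (1 + s.im * I) = ((s.re - 1 : ℝ) : ℂ) := by
      nth_rw 1 [← re_add_im s]; push_cast; ring
    rw [e, norm_real, Real.norm_eq_abs, abs_lt]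
    constructor <;> linarith

lemma sq_logHeight_le (t : ℝ) : logHeight t ^ 2 ≤ 16 * √(|t| + 3) := by
  have h0 : 0 ≤ |t| + 3 := by positivity
  have h := Real.log_le_rpow_div h0 (show (0 : ℝ) < 1 / 4 by norm_num)
  have h1 : logHeight t ≤ 4 * (|t| + 3) ^ (1 / 4 : ℝ) := by rw [logHeight]; linarith
  calc logHeight t ^ 2 ≤ (4 * (|t| + 3) ^ (1 / 4 : ℝ)) ^ 2 := by
        gcongr; linarith [one_le_logHeight t]
    _ = 16 * √(|t| + 3) := by
        rw [mul_pow, ← Real.rpow_natCast (_ ^ _), ← Real.rpow_mul h0, Real.sqrt_eq_rpow]; norm_num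

lemma exists_norm_logDeriv_riemannZeta₁_le : ∃ η : ℝ, 0 < η ∧ η ≤ 1 / 64 ∧ ∃ C : ℝ, 0 < C ∧
    ∀ s : ℂ, 1 - η / logHeight s.im ≤ s.re → s.re ≤ 2 →
      riemannZeta₁ s ≠ 0 ∧ ‖logDeriv riemannZeta₁ s‖ ≤ C * √(|s.im| + 3) := by
  obtain ⟨η, hη, hη8, hzf⟩ := exists_zero_free
  refine ⟨η / 8, by positivity, by linarith,
    16 * (48 / η * (Real.log (144 / (η / 8) ^ 2) + 4)), ?_, fun s hs hs2 => ?_⟩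
  · have : 0 < Real.log (144 / (η / 8) ^ 2) := by
      refine Real.log_pos ?_
      rw [lt_div_iff₀ (by positivity)]; nlinarith
    positivity
  set t := s.im with ht
  set L := logHeight t with hL
  have hL1 : 1 ≤ L := one_le_logHeight t
  have hdL : ∀ a : ℝ, 0 ≤ a → a / L ≤ a := fun a ha => div_le_self ha hL1
  have hηL : 0 < η / L := by positivity
  have hnz : riemannZeta₁ s ≠ 0 := by
    refine hzf s (le_trans ?_ hs)
    rw [← ht, ← hL, div_right_comm]
    linarith
  refine ⟨hnz, ?_⟩
  set x : ℝ := max s.re (1 + η / 8 / L) with hx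
  set c : ℂ := x + t * I with hc
  have hcre : c.re = x := by simp [hc]
  have hcim : c.im = t := by simp [hc]
  have hx1 : 1 + η / 8 / L ≤ x := le_max_right _ _
  have hx2 : x ≤ 2 := max_le hs2 (by linarith [hdL (η / 8) (by positivity)])
  have hxs : x - s.re ≤ η / 4 / L := by
    rw [hx, sub_le_iff_le_add, max_le_iff]
    constructor
    · have : 0 < η / 4 / L := by positivity
      linarith
    · have : η / 4 / L = η / 8 / L + η / 8 / L := by ring
      linarith
  have hsx : s.re ≤ x := le_max_left _ _
  set R : ℝ := η / 2 / L with hR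
  have hR0 : 0 < R := by positivity
  have hR1 : R ≤ 1 / 16 := (hdL _ (by positivity)).trans (by linarith)
  set M : ℝ := Real.log (144 / (η / 8) ^ 2) + 4 * L with hM
  have hlog0 : 0 < Real.log (144 / (η / 8) ^ 2) := by
    refine Real.log_pos ?_
    rw [lt_div_iff₀ (by positivity)]; nlinarith
  have hM0 : 0 < M := by positivity
  have hball : ∀ w ∈ ball c R, |w.re - x| < R ∧ |w.im - t| < R := by
    intro w hw
    rw [mem_ball, dist_eq] at hw
    constructor
    · simpa [hcre] using (abs_re_le_norm (w - c)).trans_lt hw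
    · simpa [hcim] using (abs_im_le_norm (w - c)).trans_lt hw
  have hmain : ‖logDeriv riemannZeta₁ s‖ ≤ 24 * M / R := by
    refine norm_logDeriv_le_of_ne_zero (c := c) hR0 hM0
      differentiable_riemannZeta₁.differentiableOn (fun w hw => ?_) (fun w hw => ?_) ?_
    · obtain ⟨h1, h2⟩ := hball w hw
      refine hzf w ?_
      have hw2 : logHeight w.im ≤ 2 * L := by
        refine logHeight_le_two_mul ?_
        have := abs_sub_abs_le_abs_sub w.im t
        linarith [abs_nonneg t]
      have : η / (2 * L) ≤ η / logHeight w.im := by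
        gcongr; linarith [one_le_logHeight w.im]
      rw [← div_div] at this
      have h3 := (abs_lt.1 h1).1
      have : 0 < η / 8 / L := by positivity
      linarith
    · obtain ⟨h1, h2⟩ := hball w hw
      have h3 := abs_lt.1 h1
      have h4 : 1 ≤ x := le_trans (by linarith [show 0 < η / 8 / L by positivity]) hx1
      have hw1 : ‖w‖ + 1 ≤ 2 * (|t| + 3) := by
        have := norm_le_abs_re_add_abs_im w
        have a1 := abs_sub_abs_le_abs_sub w.im t
        have a2 : |w.re| ≤ 3 := abs_le.2 ⟨by linarith, by linarith⟩
        linarith [abs_nonneg t]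
      have hw2 : ‖riemannZeta₁ w‖ ≤ 8 * (|t| + 3) ^ 2 := by
        refine (norm_riemannZeta₁_le (by linarith)).trans ?_
        calc 2 * (‖w‖ + 1) ^ 2 ≤ 2 * (2 * (|t| + 3)) ^ 2 := by gcongr
          _ = _ := by ring
      refine hw2.trans ?_
      have hlow := norm_riemannZeta₁_ge (s := c)
        (by rw [hcre]; linarith [show 0 < η / 8 / L by positivity]) (by rwa [hcre])
      rw [hcre] at hlow
      have hlow' : (η / 8 / L) ^ 2 / 18 ≤ ‖riemannZeta₁ c‖ := by
        refine le_trans ?_ hlow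
        gcongr; linarith
      have hexp : Real.exp M = 144 / (η / 8) ^ 2 * (|t| + 3) ^ 4 := by
        rw [hM, Real.exp_add, Real.exp_log (by positivity), ← exp_logHeight t, ← Real.exp_nat_mul]
        simp [hL]
      have hLt : L ≤ |t| + 3 := (Real.log_le_sub_one_of_pos (by positivity)).trans (by linarith)
      calc 8 * (|t| + 3) ^ 2 = 144 / (η / 8) ^ 2 * (L ^ 2 * (|t| + 3) ^ 2) *
            ((η / 8 / L) ^ 2 / 18) := by field_simp; norm_num
        _ ≤ 144 / (η / 8) ^ 2 * ((|t| + 3) ^ 2 * (|t| + 3) ^ 2) * ‖riemannZeta₁ c‖ := by gcongr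
        _ = _ := by rw [hexp]; ring
    · rw [mem_closedBall, dist_eq]
      have e : s - c = ((s.re - x : ℝ) : ℂ) := by
        nth_rw 1 [← re_add_im s]; rw [hc]; push_cast; ring
      rw [e, norm_real, Real.norm_eq_abs, abs_sub_comm, abs_of_nonneg (by linarith)]
      refine hxs.trans (le_of_eq ?_)
      rw [hR]; ring
  refine hmain.trans ?_
  calc 24 * M / R = 48 / η * (M * L) := by rw [hR]; field_simp; norm_num
    _ ≤ 48 / η * ((Real.log (144 / (η / 8) ^ 2) + 4) * L ^ 2) := by
        have : M ≤ (Real.log (144 / (η / 8) ^ 2) + 4) * L := by rw [hM]; nlinarith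
        have : M * L ≤ (Real.log (144 / (η / 8) ^ 2) + 4) * L * L := by gcongr
        rw [sq L, ← mul_assoc (_ + _)]
        gcongr
    _ ≤ 48 / η * ((Real.log (144 / (η / 8) ^ 2) + 4) * (16 * √(|t| + 3))) := by
        gcongr; exact sq_logHeight_le t
    _ = _ := by ring

lemma eq_integral_of_hasMellin {F : ℝ → ℂ} {M : ℂ → ℂ} {σ u : ℝ} (hu : 0 < u)
    (hF : ∀ y : ℝ, HasMellin F (σ + y * I) (M (σ + y * I)))
    (hM : Integrable fun y : ℝ => M (σ + y * I)) (hc : ContinuousAt F u) :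
    F u = (1 / (2 * Real.pi)) • ∫ y : ℝ, (u : ℂ) ^ (-(σ + y * I : ℂ)) • M (σ + y * I) := by
  have e : ∀ y : ℝ, mellin F (σ + y * I) = M (σ + y * I) := fun y => (hF y).2
  rw [← mellinInv_mellin_eq σ F hu (by simpa using (hF 0).1) ?_ hc, mellinInv]
  · simp_rw [e]
  · simpa only [VerticalIntegrable, e] using hM

lemma one_add_sq_le_norm_mul {σ : ℝ} (hσ : 1 ≤ σ) (y : ℝ) :
    1 + y ^ 2 ≤ ‖(σ + y * I : ℂ) * (σ + y * I + 1)‖ := by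
  have h1 : ‖(σ + y * I : ℂ)‖ ≤ ‖(σ + y * I + 1 : ℂ)‖ := by
    rw [show (σ + y * I + 1 : ℂ) = (σ + 1 : ℝ) + y * I by push_cast; ring, norm_add_mul_I,
      norm_add_mul_I]
    exact Real.sqrt_le_sqrt (by nlinarith)
  rw [norm_mul]
  calc 1 + y ^ 2 ≤ ‖(σ + y * I : ℂ)‖ ^ 2 := by
        rw [Complex.sq_norm, normSq_add_mul_I]; nlinarith
    _ = ‖(σ + y * I : ℂ)‖ * ‖(σ + y * I : ℂ)‖ := sq _
    _ ≤ _ := by gcongr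

lemma norm_one_div_le {σ : ℝ} (hσ : 1 ≤ σ) (y : ℝ) :
    ‖(1 / ((σ + y * I) * (σ + y * I + 1)) : ℂ)‖ ≤ (1 + y ^ 2)⁻¹ := by
  rw [norm_div, norm_one, one_div]
  exact inv_anti₀ (by positivity) (one_add_sq_le_norm_mul hσ y)

lemma mul_add_one_ne_zero {σ : ℝ} (hσ : 1 ≤ σ) (y : ℝ) :
    (σ + y * I : ℂ) * (σ + y * I + 1) ≠ 0 :=
  norm_pos_iff.1 ((by positivity : 0 < 1 + y ^ 2).trans_le (one_add_sq_le_norm_mul hσ y))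

lemma continuous_one_div_mul_add_one {σ : ℝ} (hσ : 1 ≤ σ) :
    Continuous fun y : ℝ => (1 / ((σ + y * I) * (σ + y * I + 1)) : ℂ) :=
  continuous_const.div (by fun_prop) (mul_add_one_ne_zero hσ)

lemma integrable_one_div_mul_add_one {σ : ℝ} (hσ : 1 ≤ σ) :
    Integrable fun y : ℝ => (1 / ((σ + y * I) * (σ + y * I + 1)) : ℂ) :=
  integrable_inv_one_add_sq.mono' (continuous_one_div_mul_add_one hσ).aestronglyMeasurable
    (Eventually.of_forall (norm_one_div_le hσ))

lemma sub_one_ne_zero_of_one_lt {σ : ℝ} (hσ : 1 < σ) (y : ℝ) : (σ + y * I - 1 : ℂ) ≠ 0 := by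
  intro h
  have := congrArg re h
  simp at this
  linarith

lemma integrable_one_div_sub_one_mul {σ : ℝ} (hσ : 1 < σ) :
    Integrable fun y : ℝ =>
      (1 / (σ + y * I - 1) * (1 / ((σ + y * I) * (σ + y * I + 1))) : ℂ) := by
  refine (integrable_one_div_mul_add_one hσ.le).bdd_mul (c := 1 / (σ - 1)) ?_ ?_
  · exact (continuous_const.div (by fun_prop)
      (sub_one_ne_zero_of_one_lt hσ)).aestronglyMeasurable
  · refine Eventually.of_forall fun y => ?_
    rw [norm_div, norm_one]
    refine one_div_le_one_div_of_le (by linarith) ?_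
    simpa using re_le_norm (σ + y * I - 1 : ℂ)

lemma ofReal_max_one_sub_eq_integral {σ u : ℝ} (hσ : 1 < σ) (hu : 0 < u) :
    ((max (1 - u) 0 : ℝ) : ℂ) = (1 / (2 * Real.pi)) •
      ∫ y : ℝ, (u : ℂ) ^ (-(σ + y * I : ℂ)) • (1 / ((σ + y * I) * (σ + y * I + 1)) : ℂ) := by
  set F : ℝ → ℂ := fun t => (Ioc 0 1).indicator (fun _ => 1) t -
    (Ioc 0 1).indicator (fun t : ℝ => (t : ℂ) ^ (1 : ℂ)) t with hF
  have e : ∀ t, 0 < t → F t = ((max (1 - t) 0 : ℝ) : ℂ) := by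
    intro t ht
    rw [hF]
    by_cases h : t ≤ 1
    · have : t ∈ Ioc (0 : ℝ) 1 := ⟨ht, h⟩
      simp only [indicator_of_mem this]
      rw [max_eq_left (by linarith), cpow_one]; push_cast; ring
    · have : t ∉ Ioc (0 : ℝ) 1 := fun h' => h h'.2
      simp only [indicator_of_notMem this]
      rw [max_eq_right (by linarith)]; simp
  rw [← e u hu]
  refine eq_integral_of_hasMellin (M := fun s => 1 / (s * (s + 1))) hu (fun y => ?_)
    (integrable_one_div_mul_add_one hσ.le) ?_
  · have h1 := hasMellin_one_Ioc (s := σ + y * I) (by simp; linarith)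
    have h2 := hasMellin_cpow_Ioc 1 (s := σ + y * I) (by simp; linarith)
    have h3 := hasMellin_sub h1.1 h2.1
    rw [h1.2, h2.2] at h3
    convert! h3 using 1
    have := mul_add_one_ne_zero hσ.le y
    have h4 := left_ne_zero_of_mul this
    have h5 := right_ne_zero_of_mul this
    field_simp
    ring
  · have : ContinuousAt (fun t : ℝ => ((max (1 - t) 0 : ℝ) : ℂ)) u := by fun_prop
    refine this.congr ?_
    filter_upwards [Ioi_mem_nhds hu] with t ht using (e t ht).symm

lemma ofReal_max_one_sub_sq_eq_integral {σ u : ℝ} (hσ : 1 < σ) (hu : 0 < u) :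
    ((max (1 - u) 0 ^ 2 / (2 * u) : ℝ) : ℂ) = (1 / (2 * Real.pi)) •
      ∫ y : ℝ, (u : ℂ) ^ (-(σ + y * I : ℂ)) •
        (1 / (σ + y * I - 1) * (1 / ((σ + y * I) * (σ + y * I + 1))) : ℂ) := by
  set F : ℝ → ℂ := fun t => ((1 / 2 : ℂ) • ((Ioc 0 1).indicator (fun t : ℝ => (t : ℂ) ^ (-1 : ℂ)) t +
    (Ioc 0 1).indicator (fun t : ℝ => (t : ℂ) ^ (1 : ℂ)) t)) -
      (Ioc 0 1).indicator (fun _ => 1) t with hF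
  have e : ∀ t, 0 < t → F t = ((max (1 - t) 0 ^ 2 / (2 * t) : ℝ) : ℂ) := by
    intro t ht
    have ht0 : (t : ℂ) ≠ 0 := by exact_mod_cast ht.ne'
    rw [hF]
    by_cases h : t ≤ 1
    · have : t ∈ Ioc (0 : ℝ) 1 := ⟨ht, h⟩
      simp only [indicator_of_mem this]
      rw [max_eq_left (by linarith), cpow_one, cpow_neg_one, smul_eq_mul]
      push_cast; field_simp; ring
    · have : t ∉ Ioc (0 : ℝ) 1 := fun h' => h h'.2
      simp only [indicator_of_notMem this]
      rw [max_eq_right (by linarith)]; simp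
  rw [← e u hu]
  refine eq_integral_of_hasMellin (M := fun s => 1 / (s - 1) * (1 / (s * (s + 1)))) hu
    (fun y => ?_) (integrable_one_div_sub_one_mul hσ) ?_
  · have h1 := hasMellin_one_Ioc (s := σ + y * I) (by simp; linarith)
    have h2 := hasMellin_cpow_Ioc 1 (s := σ + y * I) (by simp; linarith)
    have h0 := hasMellin_cpow_Ioc (-1) (s := σ + y * I) (by simp; linarith)
    have h3 := hasMellin_add h0.1 h2.1
    have h6 := hasMellin_const_smul h3.1 (1 / 2 : ℂ)
    have h7 := hasMellin_sub h6.1 h1.1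
    rw [h6.2, h3.2, h1.2, h2.2, h0.2] at h7
    convert! h7 using 1
    have := mul_add_one_ne_zero hσ.le y
    have h4 := left_ne_zero_of_mul this
    have h5 := right_ne_zero_of_mul this
    have h8 := sub_one_ne_zero_of_one_lt hσ y
    rw [← sub_eq_add_neg, smul_eq_mul]
    field_simp
    ring
  · have : ContinuousAt (fun t : ℝ => ((max (1 - t) 0 ^ 2 / (2 * t) : ℝ) : ℂ)) u := by
      have : ContinuousAt (fun t : ℝ => max (1 - t) 0 ^ 2 / (2 * t)) u :=
        ContinuousAt.div (by fun_prop) (by fun_prop) (by positivity)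
      exact continuous_ofReal.continuousAt.comp this
    refine this.congr ?_
    filter_upwards [Ioi_mem_nhds hu] with t ht using (e t ht).symm

lemma continuous_ofReal_cpow_vertical {x : ℝ} (hx : 0 < x) (σ : ℝ) :
    Continuous fun y : ℝ => (x : ℂ) ^ (σ + y * I : ℂ) :=
  Continuous.const_cpow (by fun_prop) (Or.inl (by exact_mod_cast hx.ne'))

lemma norm_ofReal_cpow_vertical {x : ℝ} (hx : 0 < x) (σ y : ℝ) :
    ‖(x : ℂ) ^ (σ + y * I : ℂ)‖ = x ^ σ := by
  rw [norm_cpow_eq_rpow_re_of_pos hx]; simp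

lemma hasSum_vonMangoldt_mul_max {x σ : ℝ} (hx : 0 < x) (hσ : 1 < σ) :
    HasSum (fun n : ℕ => ((Λ n * max (1 - n / x) 0 : ℝ) : ℂ)) ((1 / (2 * Real.pi)) •
      ∫ y : ℝ, (x : ℂ) ^ (σ + y * I : ℂ) * (1 / ((σ + y * I) * (σ + y * I + 1)) : ℂ) *
        LSeries (fun n => (Λ n : ℂ)) (σ + y * I)) := by
  set K : ℝ → ℂ := fun y => (1 / ((σ + y * I) * (σ + y * I + 1)) : ℂ) with hK
  set T : ℕ → ℂ → ℂ := fun n s => LSeries.term (fun n => (Λ n : ℂ)) s n with hT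
  have hσ' : ∀ y : ℝ, 1 < (σ + y * I : ℂ).re := fun y => by simpa
  have hTn : ∀ n (y : ℝ), ‖T n (σ + y * I)‖ = ‖T n σ‖ := by
    intro n y
    rw [hT]
    simp only [LSeries.norm_term_eq]
    simp
  have hTc : ∀ n, Continuous fun y : ℝ => T n (σ + y * I) := by
    intro n
    rcases eq_or_ne n 0 with rfl | hn
    · simpa [hT] using continuous_const
    · have hn0 : (n : ℂ) ≠ 0 := by exact_mod_cast hn
      simp only [hT, LSeries.term_of_ne_zero hn]
      refine continuous_const.div (Continuous.const_cpow (by fun_prop) (Or.inl hn0)) fun y => ?_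
      simp [cpow_eq_zero_iff, hn0]
  have hTint : ∀ n, Integrable fun y : ℝ => (x : ℂ) ^ (σ + y * I : ℂ) * K y * T n (σ + y * I) := by
    intro n
    refine ((integrable_one_div_mul_add_one hσ.le).bdd_mul (c := x ^ σ) ?_ ?_).mul_bdd
      (c := ‖T n σ‖) ?_ ?_
    · exact (continuous_ofReal_cpow_vertical hx σ).aestronglyMeasurable
    · exact Eventually.of_forall fun y => (norm_ofReal_cpow_vertical hx σ y).le
    · exact (hTc n).aestronglyMeasurable
    · exact Eventually.of_forall fun y => (hTn n y).le
  have hsum := hasSum_integral_of_summable_integral_norm hTint ?_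
  · have hL : ∀ y : ℝ, ∑' n, (x : ℂ) ^ (σ + y * I : ℂ) * K y * T n (σ + y * I) =
        (x : ℂ) ^ (σ + y * I : ℂ) * K y * LSeries (fun n => (Λ n : ℂ)) (σ + y * I) := by
      intro y
      rw [tsum_mul_left]; rfl
    simp_rw [hL] at hsum
    refine (hsum.const_smul (1 / (2 * Real.pi))).congr_fun ?_
    intro n
    rcases eq_or_ne n 0 with rfl | hn
    · simp [hT]
    have hn' : 0 < (n : ℝ) := by exact_mod_cast Nat.pos_of_ne_zero hn
    rw [ofReal_mul, ofReal_max_one_sub_eq_integral hσ (div_pos hn' hx), mul_smul_comm,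
      ← integral_const_mul]
    congr 2
    funext y
    have hx0 : (x : ℂ) ≠ 0 := by exact_mod_cast hx.ne'
    have hn0 : (n : ℂ) ≠ 0 := by exact_mod_cast hn
    have e : ((n : ℝ) : ℂ) ^ (σ + y * I : ℂ) =
        ((n / x : ℝ) : ℂ) ^ (σ + y * I : ℂ) * (x : ℂ) ^ (σ + y * I : ℂ) := by
      rw [← mul_cpow_ofReal_nonneg (by positivity) hx.le, ← ofReal_mul, div_mul_cancel₀ _ hx.ne']
    have hxs : (x : ℂ) ^ (σ + y * I : ℂ) ≠ 0 := by simp [cpow_eq_zero_iff, hx0]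
    rw [ofReal_natCast] at e
    simp only [hT, hK, LSeries.term_of_ne_zero hn, e, smul_eq_mul, cpow_neg]
    field_simp
  · have hs : Summable fun n => ‖T n σ‖ :=
      (ArithmeticFunction.LSeriesSummable_vonMangoldt (s := σ) (by simpa)).norm
    refine Summable.of_nonneg_of_le (fun n => integral_nonneg fun y => norm_nonneg _)
      (fun n => ?_) (hs.mul_left (x ^ σ * ∫ y : ℝ, ‖K y‖))
    refine le_of_eq ?_
    rw [mul_right_comm, ← integral_const_mul]
    congr 1
    funext y
    rw [norm_mul, norm_mul, norm_ofReal_cpow_vertical hx, hTn]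
    ring

lemma integrable_cpow_mul_LSeries_vonMangoldt {x σ : ℝ} (hx : 0 < x) (hσ : 1 < σ) :
    Integrable fun y : ℝ => (x : ℂ) ^ (σ + y * I : ℂ) *
      (1 / ((σ + y * I) * (σ + y * I + 1)) : ℂ) * LSeries (fun n => (Λ n : ℂ)) (σ + y * I) := by
  have hσ' : ∀ y : ℝ, 1 < (σ + y * I : ℂ).re := fun y => by simpa
  have hs : Summable fun n => ‖LSeries.term (fun n => (Λ n : ℂ)) σ n‖ :=
    (ArithmeticFunction.LSeriesSummable_vonMangoldt (s := σ) (by simpa)).norm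
  refine ((integrable_one_div_mul_add_one hσ.le).bdd_mul (c := x ^ σ) ?_ ?_).mul_bdd
    (c := ∑' n, ‖LSeries.term (fun n => (Λ n : ℂ)) σ n‖) ?_ ?_
  · exact (continuous_ofReal_cpow_vertical hx σ).aestronglyMeasurable
  · exact Eventually.of_forall fun y => (norm_ofReal_cpow_vertical hx σ y).le
  · refine Continuous.aestronglyMeasurable ?_
    have e : (fun y : ℝ => LSeries (fun n => (Λ n : ℂ)) (σ + y * I)) = fun y : ℝ =>
        1 / (σ + y * I - 1) - logDeriv riemannZeta₁ (σ + y * I) := by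
      funext y
      rw [logDeriv_riemannZeta₁ (hσ' y)]; ring
    rw [e]
    refine (continuous_const.div (by fun_prop) (sub_one_ne_zero_of_one_lt hσ)).sub ?_
    have hd : Continuous (deriv riemannZeta₁) :=
      (differentiable_riemannZeta₁.contDiff (n := 1)).continuous_deriv le_rfl
    exact (hd.comp (by fun_prop)).div (differentiable_riemannZeta₁.continuous.comp (by fun_prop))
      fun y => riemannZeta₁_ne_zero_of_one_le_re (hσ' y).le
  · refine Eventually.of_forall fun y => ?_
    refine tsum_of_norm_bounded hs.hasSum fun n => le_of_eq ?_
    simp only [LSeries.norm_term_eq]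
    simp

/-- The integrand of the inverse Mellin transform of the smoothed Chebyshev remainder. -/
noncomputable def remainderIntegrand (x : ℝ) (s : ℂ) : ℂ :=
  (x : ℂ) ^ s * (1 / (s * (s + 1))) * -logDeriv riemannZeta₁ s

lemma integrable_remainderIntegrand {x σ : ℝ} (hx : 0 < x) (hσ : 1 < σ) :
    Integrable fun y : ℝ => remainderIntegrand x (σ + y * I) := by
  have h1 := integrable_cpow_mul_LSeries_vonMangoldt hx hσ
  have h2 := (integrable_one_div_sub_one_mul hσ).bdd_mul (c := x ^ σ)
    (continuous_ofReal_cpow_vertical hx σ).aestronglyMeasurable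
    (Eventually.of_forall fun y => (norm_ofReal_cpow_vertical hx σ y).le)
  refine (h1.sub h2).congr (Eventually.of_forall fun y => ?_)
  simp only [Pi.sub_apply]
  rw [remainderIntegrand, logDeriv_riemannZeta₁ (by simpa)]
  ring

lemma hasSum_vonMangoldt_mul_max_remainder {x σ : ℝ} (hx : 1 ≤ x) (hσ : 1 < σ) :
    HasSum (fun n : ℕ => ((Λ n * max (1 - n / x) 0 : ℝ) : ℂ)) (((x - 1) ^ 2 / (2 * x) : ℝ) +
      (1 / (2 * Real.pi)) • ∫ y : ℝ, remainderIntegrand x (σ + y * I)) := by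
  have hx0 : 0 < x := by linarith
  have h := hasSum_vonMangoldt_mul_max hx0 hσ
  convert h using 1
  have h1 := integrable_cpow_mul_LSeries_vonMangoldt hx0 hσ
  have h2 := (integrable_one_div_sub_one_mul hσ).bdd_mul (c := x ^ σ)
    (continuous_ofReal_cpow_vertical hx0 σ).aestronglyMeasurable
    (Eventually.of_forall fun y => (norm_ofReal_cpow_vertical hx0 σ y).le)
  have h3 := ofReal_max_one_sub_sq_eq_integral hσ (inv_pos.2 hx0)
  have e : max (1 - x⁻¹) 0 ^ 2 / (2 * x⁻¹) = (x - 1) ^ 2 / (2 * x) := by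
    rw [max_eq_left (by linarith [inv_le_one_of_one_le₀ hx])]
    field_simp
  have e2 : ∀ y : ℝ, ((x⁻¹ : ℝ) : ℂ) ^ (-(σ + y * I : ℂ)) = (x : ℂ) ^ (σ + y * I : ℂ) := by
    intro y
    rw [ofReal_inv, inv_cpow, cpow_neg, inv_inv]
    rw [arg_ofReal_of_nonneg hx0.le]
    exact Real.pi_pos.ne
  rw [e] at h3
  simp_rw [e2, smul_eq_mul] at h3
  rw [h3, ← smul_add, ← integral_add h2 (integrable_remainderIntegrand hx0 hσ)]
  congr 2
  funext y
  rw [remainderIntegrand, logDeriv_riemannZeta₁ (by simpa)]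
  ring

lemma sqrt_abs_add_three_le (t : ℝ) : √(|t| + 3) ≤ 2 * (1 + t ^ 2) ^ (1 / 4 : ℝ) := by
  have h1 : |t| + 3 ≤ 4 * √(1 + t ^ 2) := by
    refine le_of_sq_le_sq ?_ (by positivity)
    rw [mul_pow, Real.sq_sqrt (by positivity)]
    nlinarith [sq_abs t, sq_nonneg (|t| - 1)]
  calc √(|t| + 3) ≤ √(4 * √(1 + t ^ 2)) := Real.sqrt_le_sqrt h1
    _ = 2 * (1 + t ^ 2) ^ (1 / 4 : ℝ) := by
      rw [Real.sqrt_mul (by norm_num), Real.sqrt_eq_rpow (√_), Real.sqrt_eq_rpow (1 + t ^ 2),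
        ← Real.rpow_mul (by positivity), show (4 : ℝ) = 2 ^ 2 by norm_num,
        Real.sqrt_sq (by norm_num)]
      norm_num

lemma exists_norm_remainderIntegrand_le : ∃ η : ℝ, 0 < η ∧ η ≤ 1 / 64 ∧ ∃ C : ℝ, 0 < C ∧
    ∀ x : ℝ, 0 < x → ∀ s : ℂ, 1 - η / logHeight s.im ≤ s.re → s.re ≤ 2 →
      DifferentiableAt ℂ (remainderIntegrand x) s ∧
      ‖remainderIntegrand x s‖ ≤ C * x ^ s.re * (1 + s.im ^ 2) ^ (-(3 / 4) : ℝ) := by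
  obtain ⟨η, hη, hη', C, hC, h⟩ := exists_norm_logDeriv_riemannZeta₁_le
  refine ⟨η, hη, hη', 8 * C, by positivity, fun x hx s hs hs2 => ?_⟩
  obtain ⟨hnz, hb⟩ := h s hs hs2
  have hre : 1 / 2 ≤ s.re := by
    have : η / logHeight s.im ≤ η := div_le_self hη.le (one_le_logHeight _)
    linarith
  set D : ℝ := 1 + s.im ^ 2 with hD
  have hD0 : 0 < D := by positivity
  have hle : D / 4 ≤ ‖s * (s + 1)‖ := by
    have h1 : ‖s‖ ≤ ‖s + 1‖ := by
      rw [← sq_le_sq₀ (norm_nonneg _) (norm_nonneg _), Complex.sq_norm, Complex.sq_norm,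
        normSq_apply, normSq_apply]
      simp
      nlinarith
    rw [norm_mul]
    calc D / 4 ≤ ‖s‖ ^ 2 := by rw [Complex.sq_norm, normSq_apply]; nlinarith
      _ = ‖s‖ * ‖s‖ := sq _
      _ ≤ _ := by gcongr
  have hne : s * (s + 1) ≠ 0 := norm_pos_iff.1 (lt_of_lt_of_le (by positivity) hle)
  constructor
  · unfold remainderIntegrand logDeriv
    have h1 : DifferentiableAt ℂ (fun s : ℂ => (x : ℂ) ^ s) s :=
      differentiableAt_id.const_cpow (Or.inl (by exact_mod_cast hx.ne'))
    have h2 : DifferentiableAt ℂ (deriv riemannZeta₁) s :=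
      ((differentiable_riemannZeta₁.contDiff (n := 2)).differentiable_deriv_two) s
    have h3 : DifferentiableAt ℂ (deriv riemannZeta₁ / riemannZeta₁) s :=
      h2.div (differentiable_riemannZeta₁ s) hnz
    have h4 : DifferentiableAt ℂ (fun s : ℂ => 1 / (s * (s + 1))) s :=
      DifferentiableAt.div (by fun_prop) (by fun_prop) hne
    exact (h1.mul h4).mul h3.neg
  · rw [remainderIntegrand, norm_mul, norm_mul, norm_neg, norm_cpow_eq_rpow_re_of_pos hx,
      norm_div, norm_one]
    calc x ^ s.re * (1 / ‖s * (s + 1)‖) * ‖logDeriv riemannZeta₁ s‖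
        ≤ x ^ s.re * (1 / (D / 4)) * (C * (2 * D ^ (1 / 4 : ℝ))) := by
          gcongr
          exact hb.trans (by gcongr; exact sqrt_abs_add_three_le _)
      _ = 8 * C * x ^ s.re * (D ^ (1 / 4 : ℝ) * D⁻¹) := by field_simp; norm_num
      _ = _ := by
          rw [← Real.rpow_neg_one D, ← Real.rpow_add hD0]; norm_num

lemma integrable_one_add_sq_rpow :
    Integrable fun t : ℝ => (1 + t ^ 2) ^ (-(5 / 8) : ℝ) := by
  have h := integrable_rpow_neg_one_add_norm_sq (E := ℝ) (μ := volume) (r := 5 / 4)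
    (by norm_num)
  refine h.congr (Eventually.of_forall fun t => ?_)
  simp only [Real.norm_eq_abs, sq_abs]
  norm_num

lemma one_add_sq_rpow_le (t : ℝ) :
    (1 + t ^ 2) ^ (-(3 / 4) : ℝ) ≤ (1 + t ^ 2) ^ (-(5 / 8) : ℝ) :=
  Real.rpow_le_rpow_of_exponent_le (by nlinarith) (by norm_num)

lemma one_add_sq_rpow_le_of_le_abs {t T : ℝ} (hT : 0 < T) (h : T ≤ |t|) :
    (1 + t ^ 2) ^ (-(3 / 4) : ℝ) ≤ T ^ (-(1 / 4) : ℝ) * (1 + t ^ 2) ^ (-(5 / 8) : ℝ) := by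
  have h0 : 0 < 1 + t ^ 2 := by positivity
  rw [show (-(3 / 4) : ℝ) = -(1 / 8) + -(5 / 8) by norm_num, Real.rpow_add h0]
  gcongr
  calc (1 + t ^ 2) ^ (-(1 / 8) : ℝ) ≤ (T ^ 2) ^ (-(1 / 8) : ℝ) := by
        refine Real.rpow_le_rpow_of_nonpos (by positivity) ?_ (by norm_num)
        nlinarith [sq_abs t]
    _ = _ := by
        rw [← Real.rpow_natCast T 2, ← Real.rpow_mul hT.le]; norm_num

lemma exists_norm_integral_remainderIntegrand_le : ∃ c : ℝ, 0 < c ∧ c ≤ 1 ∧ ∃ C : ℝ, 0 < C ∧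
    ∀ x : ℝ, Real.exp 1 ≤ x → ∃ σ : ℝ, 1 < σ ∧
      ‖∫ y : ℝ, remainderIntegrand x (σ + y * I)‖ ≤ C * x * Real.exp (-c * √(Real.log x)) := by
  obtain ⟨η, hη, hη', C, hC, hG⟩ := exists_norm_remainderIntegrand_le
  set W : ℝ := ∫ t : ℝ, (1 + t ^ 2) ^ (-(5 / 8) : ℝ) with hW
  have hW0 : 0 ≤ W := integral_nonneg fun t => by positivity
  refine ⟨η / 3, by positivity, by linarith, C * (W + Real.exp 1 * (W + 4)), by positivity,
    fun x hx => ?_⟩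
  have hx0 : 0 < x := (Real.exp_pos 1).trans_le hx
  have hlog : 1 ≤ Real.log x := (Real.le_log_iff_exp_le hx0).2 hx
  have hx1 : 1 ≤ x := by linarith [Real.add_one_le_exp 1]
  set y : ℝ := √(Real.log x) with hy
  have hy1 : 1 ≤ y := Real.one_le_sqrt.2 hlog
  have hysq : y ^ 2 = Real.log x := Real.sq_sqrt (by linarith)
  set T : ℝ := Real.exp y with hT
  have hT0 : 0 < T := Real.exp_pos _
  have hT2 : 2 ≤ T := by linarith [Real.add_one_le_exp y]
  set c : ℝ := 1 + 1 / Real.log x with hc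
  have hc1 : 1 < c := by rw [hc]; have : 0 < 1 / Real.log x := by positivity
                         linarith
  have hc2 : c ≤ 2 := by
    have : 1 / Real.log x ≤ 1 := by rw [div_le_one (by linarith)]; exact hlog
    linarith
  have hxc : x ^ c = Real.exp 1 * x := by
    rw [hc, Real.rpow_add hx0, Real.rpow_one, Real.rpow_def_of_pos hx0, mul_one_div_cancel
      (by linarith)]
    ring
  have hTL : logHeight T ≤ 3 * y := by
    rw [logHeight, abs_of_pos hT0, Real.log_le_iff_le_exp (by positivity),
      show 3 * y = (3 : ℕ) * y by norm_num, Real.exp_nat_mul, ← hT]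
    nlinarith [mul_nonneg (sub_nonneg.2 hT2) (sq_nonneg T)]
  set σ : ℝ := 1 - η / logHeight T with hσ
  have hTL1 := one_le_logHeight T
  have hσ1 : σ ≤ 1 := by
    have : 0 < η / logHeight T := by positivity
    linarith
  have hσ0 : 0 ≤ σ := by
    have : η / logHeight T ≤ η := div_le_self hη.le hTL1
    linarith
  have hxσ : x ^ σ ≤ x * Real.exp (-(η / 3) * y) := by
    have e : x * Real.exp (-(η / 3) * y) = x ^ (1 - η / (3 * y)) := by
      rw [Real.rpow_def_of_pos hx0]
      nth_rw 1 [← Real.exp_log hx0]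
      rw [← Real.exp_add, ← hysq]
      congr 1
      field_simp
      ring
    rw [e]
    refine Real.rpow_le_rpow_of_exponent_le hx1 ?_
    have : η / (3 * y) ≤ η / logHeight T := by gcongr
    linarith
  have hT4 : T ^ (-(1 / 4) : ℝ) ≤ Real.exp (-(η / 3) * y) := by
    rw [hT, ← Real.exp_mul]
    refine Real.exp_le_exp.2 ?_
    nlinarith
  have hstrip : ∀ u t : ℝ, σ ≤ u → u ≤ c → |t| ≤ T →
      DifferentiableAt ℂ (remainderIntegrand x) (u + t * I) ∧
      ‖remainderIntegrand x (u + t * I)‖ ≤ C * x ^ u * (1 + t ^ 2) ^ (-(3 / 4) : ℝ) := by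
    intro u t h1 h2 h3
    have h := hG x hx0 (u + t * I) ?_ (by simp; linarith)
    · simpa using h
    · simp only [add_im, ofReal_im, mul_im, ofReal_re, I_im, mul_one, I_re, mul_zero, zero_add,
        add_zero, add_re, mul_re, sub_self]
      refine le_trans ?_ h1
      have : logHeight t ≤ logHeight T :=
        Real.log_le_log (by positivity) (by rw [abs_of_pos hT0]; linarith)
      have : η / logHeight T ≤ η / logHeight t := by
        gcongr; linarith [one_le_logHeight t]
      linarith
  have hline : ∀ t : ℝ, ‖remainderIntegrand x (c + t * I)‖ ≤
      C * x ^ c * (1 + t ^ 2) ^ (-(3 / 4) : ℝ) := by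
    intro t
    have h := (hG x hx0 (c + t * I) ?_ (by simpa)).2
    · simpa using h
    · have : 0 < η / logHeight t := div_pos hη (by linarith [one_le_logHeight t])
      simp
      linarith
  have hT4' : (1 + T ^ 2) ^ (-(3 / 4) : ℝ) ≤ T ^ (-(1 / 4) : ℝ) := by
    refine (one_add_sq_rpow_le_of_le_abs hT0 (abs_of_pos hT0).ge).trans ?_
    refine mul_le_of_le_one_right (by positivity) ?_
    exact Real.rpow_le_one_of_one_le_of_nonpos (by nlinarith) (by norm_num)
  have hhor : ∀ t : ℝ, |t| = T → ‖∫ u in σ..c, remainderIntegrand x (u + t * I)‖ ≤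
      C * x ^ c * T ^ (-(1 / 4) : ℝ) * 2 := by
    intro t ht
    have h := intervalIntegral.norm_integral_le_of_norm_le_const (a := σ) (b := c)
      (f := fun u : ℝ => remainderIntegrand x (u + t * I))
      (C := C * x ^ c * T ^ (-(1 / 4) : ℝ)) ?_
    · refine h.trans ?_
      gcongr
      rw [abs_of_nonneg (by linarith)]; linarith
    · intro u hu
      rw [uIoc_of_le (by linarith)] at hu
      refine (hstrip u t hu.1.le hu.2 ht.le).2.trans ?_
      rw [← sq_abs t, ht]
      gcongr
      exact hu.2
  have hleft : ‖∫ t in (-T)..T, remainderIntegrand x (σ + t * I)‖ ≤ C * x ^ σ * W := by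
    rw [intervalIntegral.integral_of_le (by linarith)]
    have hi := integrable_one_add_sq_rpow.const_mul (C * x ^ σ)
    refine (norm_integral_le_of_norm_le hi.integrableOn ?_).trans ?_
    · filter_upwards [ae_restrict_mem measurableSet_Ioc] with t ht
      refine (hstrip σ t le_rfl (by linarith) (abs_le.2 ⟨ht.1.le, ht.2⟩)).2.trans ?_
      exact mul_le_mul_of_nonneg_left (one_add_sq_rpow_le t) (by positivity)
    · rw [← integral_const_mul]
      exact setIntegral_le_integral hi (Eventually.of_forall fun t => by positivity)
  have htail : ‖∫ t in (Ioc (-T) T)ᶜ, remainderIntegrand x (c + t * I)‖ ≤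
      C * x ^ c * T ^ (-(1 / 4) : ℝ) * W := by
    have hi := integrable_one_add_sq_rpow.const_mul (C * x ^ c * T ^ (-(1 / 4) : ℝ))
    refine (norm_integral_le_of_norm_le hi.integrableOn ?_).trans ?_
    · filter_upwards [ae_restrict_mem measurableSet_Ioc.compl] with t ht
      refine (hline t).trans ?_
      rw [mul_assoc _ (T ^ _)]
      gcongr
      refine one_add_sq_rpow_le_of_le_abs hT0 ?_
      by_contra! h
      exact ht ⟨(abs_lt.1 h).1, (abs_lt.1 h).2.le⟩
    · rw [← integral_const_mul]
      exact setIntegral_le_integral hi (Eventually.of_forall fun t => by positivity)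
  have hrect := integral_boundary_rect_eq_zero_of_differentiableOn (remainderIntegrand x)
    (σ + (-T : ℝ) * I) (c + T * I) ?_
  swap
  · intro s hs
    rw [mem_reProdIm] at hs
    simp only [add_re, ofReal_re, mul_re, I_re, mul_zero, ofReal_im, I_im, mul_one, sub_self,
      add_zero, add_im, mul_im, zero_add] at hs
    rw [uIcc_of_le (by linarith), uIcc_of_le (by linarith)] at hs
    have h := (hstrip s.re s.im hs.1.1 hs.1.2 (abs_le.2 hs.2)).1
    rw [re_add_im] at h
    exact h.differentiableWithinAt
  simp only [add_re, ofReal_re, mul_re, I_re, mul_zero, ofReal_im, I_im, mul_one, sub_self,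
    add_zero, add_im, mul_im, zero_add] at hrect
  have h1 := hhor (-T) (by rw [abs_neg, abs_of_pos hT0])
  have h2 := hhor T (abs_of_pos hT0)
  refine ⟨c, hc1, ?_⟩
  rw [← integral_add_compl (measurableSet_Ioc (a := -T) (b := T))
    (integrable_remainderIntegrand hx0 hc1), ← intervalIntegral.integral_of_le (by linarith)]
  set A := ∫ t in (-T)..T, remainderIntegrand x (c + t * I) with hA
  set B := ∫ t in (-T)..T, remainderIntegrand x (σ + t * I) with hB
  set H1 := ∫ u in σ..c, remainderIntegrand x (u + (-T : ℝ) * I) with hH1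
  set H2 := ∫ u in σ..c, remainderIntegrand x (u + T * I) with hH2
  have hAB : ‖A‖ ≤ ‖B‖ + (‖H1‖ + ‖H2‖) := by
    have e : I • A = I • B + (H2 - H1) := by
      linear_combination hrect
    calc ‖A‖ = ‖I • A‖ := by rw [norm_smul, norm_I, one_mul]
      _ ≤ ‖I • B‖ + ‖H2 - H1‖ := by rw [e]; exact norm_add_le _ _
      _ ≤ _ := by
        rw [norm_smul, norm_I, one_mul]
        gcongr
        rw [add_comm]; exact norm_sub_le _ _
  calc _ ≤ ‖A‖ + C * x ^ c * T ^ (-(1 / 4) : ℝ) * W := (norm_add_le _ _).trans (by gcongr)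
    _ ≤ C * x ^ σ * W + (C * x ^ c * T ^ (-(1 / 4) : ℝ) * 2 + C * x ^ c * T ^ (-(1 / 4) : ℝ) * 2) +
        C * x ^ c * T ^ (-(1 / 4) : ℝ) * W := by
        gcongr
        exact hAB.trans (by gcongr)
    _ = C * x ^ σ * W + C * (Real.exp 1 * x) * (W + 4) * T ^ (-(1 / 4) : ℝ) := by rw [hxc]; ring
    _ ≤ C * (x * Real.exp (-(η / 3) * y)) * W +
        C * (Real.exp 1 * x) * (W + 4) * Real.exp (-(η / 3) * y) := by gcongr
    _ = _ := by ring

lemma exists_abs_sum_vonMangoldt_mul_max_sub_le : ∃ c : ℝ, 0 < c ∧ c ≤ 1 ∧ ∃ C : ℝ, 0 < C ∧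
    ∀ x : ℝ, Real.exp 1 ≤ x → ∃ S : ℝ, HasSum (fun n : ℕ => Λ n * max (1 - n / x) 0) S ∧
      |S - x / 2| ≤ C * x * Real.exp (-c * √(Real.log x)) := by
  obtain ⟨c, hc, hc1, C, hC, h⟩ := exists_norm_integral_remainderIntegrand_le
  refine ⟨c, hc, hc1, C + 1, by positivity, fun x hx => ?_⟩
  obtain ⟨σ, hσ, hb⟩ := h x hx
  have hx0 : 0 < x := (Real.exp_pos 1).trans_le hx
  have hx1 : 1 ≤ x := by linarith [Real.add_one_le_exp 1]
  have hlog : 1 ≤ Real.log x := (Real.le_log_iff_exp_le hx0).2 hx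
  set J := ∫ y : ℝ, remainderIntegrand x (σ + y * I) with hJ
  have hs := hasSum_re (hasSum_vonMangoldt_mul_max_remainder hx1 hσ)
  simp only [ofReal_re] at hs
  refine ⟨_, hs, ?_⟩
  set y : ℝ := √(Real.log x) with hy
  have hy1 : 1 ≤ y := Real.one_le_sqrt.2 hlog
  have hysq : y ^ 2 = Real.log x := Real.sq_sqrt (by linarith)
  have h1 : 1 ≤ x * Real.exp (-c * y) := by
    nth_rw 1 [← Real.exp_log hx0]
    rw [← Real.exp_add, ← hysq]
    exact Real.one_le_exp (by nlinarith)
  have h2 : |((1 / (2 * Real.pi)) • J).re| ≤ ‖J‖ := by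
    refine (abs_re_le_norm _).trans ?_
    rw [norm_smul, Real.norm_of_nonneg (by positivity)]
    refine mul_le_of_le_one_left (norm_nonneg _) ?_
    rw [div_le_one (by positivity)]
    linarith [Real.pi_gt_three]
  have h3 : |(x - 1) ^ 2 / (2 * x) - x / 2| ≤ 1 := by
    have : (x - 1) ^ 2 / (2 * x) - x / 2 = -1 + 1 / (2 * x) := by field_simp; ring
    rw [this]
    have : 1 / (2 * x) ≤ 1 := by rw [div_le_one (by positivity)]; linarith
    have : 0 < 1 / (2 * x) := by positivity
    rw [abs_le]; constructor <;> linarith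
  rw [add_re, ofReal_re]
  calc _ = |((x - 1) ^ 2 / (2 * x) - x / 2) + ((1 / (2 * Real.pi)) • J).re| := by congr 1; ring
    _ ≤ 1 + ‖J‖ := (abs_add_le _ _).trans (add_le_add h3 h2)
    _ ≤ x * Real.exp (-c * y) + C * x * Real.exp (-c * y) := add_le_add h1 hb
    _ = _ := by ring

lemma hasSum_vonMangoldt_indicator (x : ℝ) (hx : 0 ≤ x) :
    HasSum (fun n : ℕ => if (n : ℝ) ≤ x then Λ n else 0) (Chebyshev.psi x) := by
  have h := hasSum_sum_of_ne_finset_zero (s := Finset.Icc 0 ⌊x⌋₊)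
    (f := fun n : ℕ => if (n : ℝ) ≤ x then Λ n else 0) (L := .unconditional ℕ) ?_
  · rw [Chebyshev.psi_eq_sum_Icc]
    convert h using 1
    refine Finset.sum_congr rfl fun n hn => ?_
    rw [if_pos ((Nat.le_floor_iff hx).1 (Finset.mem_Icc.1 hn).2)]
  · intro n hn
    rw [if_neg]
    intro h
    exact hn (Finset.mem_Icc.2 ⟨n.zero_le, (Nat.le_floor_iff hx).2 h⟩)

lemma sqrt_sub_sqrt_le {a b : ℝ} (hb : b ≤ a) : √a ≤ √b + √(a - b) := by
  rcases le_or_gt b 0 with h | h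
  · exact (Real.sqrt_le_sqrt (by linarith)).trans (le_add_of_nonneg_left (Real.sqrt_nonneg _))
  · refine Real.sqrt_le_iff.2 ⟨by positivity, ?_⟩
    nlinarith [Real.sq_sqrt h.le, Real.sq_sqrt (sub_nonneg.2 hb),
      mul_nonneg (Real.sqrt_nonneg b) (Real.sqrt_nonneg (a - b))]

lemma exists_abs_psi_sub_le_of_six_le : ∃ c : ℝ, 0 < c ∧ c ≤ 1 / 2 ∧ ∃ C : ℝ, 0 < C ∧
    ∀ x : ℝ, 6 ≤ x → |Chebyshev.psi x - x| ≤ C * x * Real.exp (-c * √(Real.log x)) := by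
  obtain ⟨c, hc, hc1, C, hC, h⟩ := exists_abs_sum_vonMangoldt_mul_max_sub_le
  refine ⟨c / 2, by positivity, by linarith, 8 * C + 1, by positivity, fun x hx => ?_⟩
  have hx0 : 0 < x := by linarith
  have he : Real.exp 1 ≤ 3 := by linarith [Real.exp_one_lt_d9]
  have hA : ∀ u : ℝ, Real.exp 1 ≤ u → ∃ S : ℝ, HasSum (fun n : ℕ => Λ n * max (u - n) 0) S ∧
      |S - u ^ 2 / 2| ≤ C * u ^ 2 * Real.exp (-c * √(Real.log u)) := by
    intro u hu
    have hu0 : 0 < u := (Real.exp_pos 1).trans_le hu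
    obtain ⟨S, hS, hb⟩ := h u hu
    refine ⟨u * S, ?_, ?_⟩
    · have e : (fun n : ℕ => Λ n * max (u - n) 0) = fun n : ℕ => u * (Λ n * max (1 - n / u) 0) := by
        funext n
        rw [mul_left_comm, mul_max_of_nonneg _ _ hu0.le, mul_zero, mul_sub, mul_one,
          mul_div_cancel₀ _ hu0.ne']
      rw [e]
      exact hS.mul_left u
    · rw [show u * S - u ^ 2 / 2 = u * (S - u / 2) by ring, abs_mul, abs_of_pos hu0]
      calc u * |S - u / 2| ≤ u * (C * u * Real.exp (-c * √(Real.log u))) := by gcongr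
        _ = _ := by ring
  set y : ℝ := √(Real.log x) with hy
  set F : ℝ := Real.exp (-(c / 2) * y) with hF
  have hF0 : 0 < F := Real.exp_pos _
  have hF1 : F ≤ 1 := Real.exp_le_one_iff.2 (by
    have : 0 ≤ c / 2 * y := mul_nonneg (by linarith) (Real.sqrt_nonneg _)
    linarith)
  have hFF : Real.exp (-c * y) = F ^ 2 := by
    rw [hF, ← Real.exp_nat_mul]; congr 1; push_cast; ring
  set d : ℝ := x * F / 2 with hd
  have hd0 : 0 < d := by positivity
  have hdx : d ≤ x / 2 := by rw [hd]; nlinarith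
  obtain ⟨S, hS, hSb⟩ := hA x (by linarith)
  obtain ⟨S1, hS1, hS1b⟩ := hA (x + d) (by linarith)
  obtain ⟨S2, hS2, hS2b⟩ := hA (x - d) (by linarith)
  rw [← hy, hFF] at hSb
  have hE1 : Real.exp (-c * √(Real.log (x + d))) ≤ F ^ 2 := by
    rw [← hFF]
    refine Real.exp_le_exp.2 ?_
    have : y ≤ √(Real.log (x + d)) :=
      Real.sqrt_le_sqrt (Real.log_le_log hx0 (by linarith))
    nlinarith
  have hE2 : Real.exp (-c * √(Real.log (x - d))) ≤ 3 * F ^ 2 := by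
    rw [← hFF]
    have h1 : y ≤ √(Real.log (x - d)) + 1 := by
      refine (sqrt_sub_sqrt_le (Real.log_le_log (by linarith) (by linarith : x - d ≤ x))).trans ?_
      gcongr
      rw [Real.sqrt_le_left one_pos.le, one_pow, ← Real.log_div (by linarith) (by linarith)]
      have : x / (x - d) ≤ 2 := by rw [div_le_iff₀ (by linarith)]; linarith
      calc Real.log (x / (x - d)) ≤ Real.log 2 :=
            Real.log_le_log (div_pos hx0 (by linarith)) this
        _ ≤ 1 := by linarith [Real.log_two_lt_d9]
    calc Real.exp (-c * √(Real.log (x - d))) ≤ Real.exp (1 + -c * y) :=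
          Real.exp_le_exp.2 (by nlinarith)
      _ = Real.exp 1 * Real.exp (-c * y) := Real.exp_add _ _
      _ ≤ _ := by gcongr
  have hpsi := (hasSum_vonMangoldt_indicator x hx0.le).mul_right d
  have hup : Chebyshev.psi x * d ≤ S1 - S := by
    refine hasSum_le (fun n => ?_) hpsi (hS1.sub hS)
    have hL : 0 ≤ Λ n := ArithmeticFunction.vonMangoldt_nonneg
    rw [← mul_sub]
    split_ifs with hn
    · rw [max_eq_left (by linarith), max_eq_left (by linarith)]
      gcongr; linarith
    · rw [zero_mul]
      refine mul_nonneg hL (sub_nonneg.2 ?_)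
      gcongr; linarith
  have hlow : S - S2 ≤ Chebyshev.psi x * d := by
    refine hasSum_le (fun n => ?_) (hS.sub hS2) hpsi
    have hL : 0 ≤ Λ n := ArithmeticFunction.vonMangoldt_nonneg
    rw [← mul_sub]
    split_ifs with hn
    · gcongr
      rw [max_eq_left (by linarith)]
      linarith [le_max_left (x - d - n) 0]
    · rw [max_eq_right (by linarith), max_eq_right (by linarith)]
      simp
  have b0 := abs_le.1 hSb
  have b1 := (abs_le.1 hS1b).2
  have b2 := (abs_le.1 hS2b).2
  have b1' : C * (x + d) ^ 2 * Real.exp (-c * √(Real.log (x + d))) ≤ C * (3 * x ^ 2) * F ^ 2 := by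
    gcongr
    nlinarith
  have b2' : C * (x - d) ^ 2 * Real.exp (-c * √(Real.log (x - d))) ≤
      C * x ^ 2 * (3 * F ^ 2) := by
    gcongr
    · linarith
    · linarith
  have key : 4 * C * x ^ 2 * F ^ 2 = (8 * C * x * F) * d := by rw [hd]; ring
  have hd2 : d / 2 ≤ x * F := by rw [hd]; nlinarith [mul_pos hx0 hF0]
  have i1 : (x + d) ^ 2 / 2 = x ^ 2 / 2 + x * d + d / 2 * d := by ring
  have i2 : (x - d) ^ 2 / 2 = x ^ 2 / 2 - x * d + d / 2 * d := by ring
  have i3 : C * (3 * x ^ 2) * F ^ 2 + C * x ^ 2 * F ^ 2 = 8 * C * x * F * d := by rw [← key]; ring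
  have i4 : C * x ^ 2 * (3 * F ^ 2) + C * x ^ 2 * F ^ 2 = 8 * C * x * F * d := by rw [← key]; ring
  have i5 : (8 * C + 1) * x * F = 8 * C * x * F + x * F := by ring
  rw [abs_le]
  constructor
  · have : (x - d / 2 - 8 * C * x * F) * d ≤ Chebyshev.psi x * d := by
      rw [sub_mul, sub_mul]
      linarith only [b0.1, b2, b2', hlow, i2, i4]
    have := le_of_mul_le_mul_right this hd0
    linarith only [this, hd2, i5]
  · have : Chebyshev.psi x * d ≤ (x + d / 2 + 8 * C * x * F) * d := by
      rw [add_mul, add_mul]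
      linarith only [b0.1, b1, b1', hup, i1, i3]
    have := le_of_mul_le_mul_right this hd0
    linarith only [this, hd2, i5]

lemma sqrt_mul_log_le {x c : ℝ} (hx : 1 ≤ x) (hc0 : 0 ≤ c) (hc : c ≤ 1) :
    √x * Real.log x ≤ 12 * x * Real.exp (-c * √(Real.log x)) := by
  have hx0 : 0 < x := by linarith
  set y : ℝ := √(Real.log x) with hy
  have hysq : y ^ 2 = Real.log x := Real.sq_sqrt (Real.log_nonneg hx)
  have hy0 : 0 ≤ y := Real.sqrt_nonneg _
  have hxe : x = Real.exp (y ^ 2) := by rw [hysq, Real.exp_log hx0]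
  have hsx : √x = Real.exp (y ^ 2 / 2) := by rw [hxe, Real.exp_half]
  have h1 : y ^ 2 ≤ 4 * Real.exp (y ^ 2 / 4) := by linarith [Real.add_one_le_exp (y ^ 2 / 4)]
  rw [← hysq, hsx]
  calc Real.exp (y ^ 2 / 2) * y ^ 2 ≤ Real.exp (y ^ 2 / 2) * (4 * Real.exp (y ^ 2 / 4)) := by gcongr
    _ = 4 * Real.exp (y ^ 2 * (3 / 4)) := by
      rw [mul_left_comm, ← Real.exp_add]; congr 2; ring
    _ ≤ 4 * Real.exp (1 + y ^ 2 + -c * y) := by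
      gcongr
      nlinarith [sq_nonneg (y - 2)]
    _ = 4 * Real.exp 1 * x * Real.exp (-c * y) := by rw [Real.exp_add, Real.exp_add, ← hxe]; ring
    _ ≤ _ := by
      gcongr
      linarith [Real.exp_one_lt_d9]

lemma exists_abs_theta_sub_le : ∃ c : ℝ, 0 < c ∧ c ≤ 1 / 2 ∧ ∃ C : ℝ, 0 < C ∧
    ∀ x : ℝ, 2 ≤ x → |Chebyshev.theta x - x| ≤ C * x * Real.exp (-c * √(Real.log x)) := by
  obtain ⟨c, hc, hc1, C, hC, h⟩ := exists_abs_psi_sub_le_of_six_le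
  refine ⟨c, hc, hc1, C + 24, by positivity, fun x hx => ?_⟩
  have hx0 : 0 < x := by linarith
  have hE : 0 < Real.exp (-c * √(Real.log x)) := Real.exp_pos _
  rcases le_or_gt 6 x with h6 | h6
  · have h1 := h x h6
    have h2 := Chebyshev.abs_psi_sub_theta_le_sqrt_mul_log (show 1 ≤ x by linarith)
    have h3 := sqrt_mul_log_le (show 1 ≤ x by linarith) hc.le (by linarith)
    calc |Chebyshev.theta x - x|
        = |(Chebyshev.psi x - x) - (Chebyshev.psi x - Chebyshev.theta x)| := by congr 1; ring
      _ ≤ |Chebyshev.psi x - x| + |Chebyshev.psi x - Chebyshev.theta x| := abs_sub _ _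
      _ ≤ _ := by nlinarith
  · have h1 : 1 / 3 ≤ Real.exp (-c * √(Real.log x)) := by
      have : √(Real.log x) ≤ 2 := by
        rw [Real.sqrt_le_left (by norm_num)]
        rw [Real.log_le_iff_le_exp hx0, show (2 : ℝ) ^ 2 = (4 : ℕ) * 1 by norm_num,
          Real.exp_nat_mul]
        calc x ≤ 2 ^ 4 := by linarith
          _ ≤ _ := by gcongr; linarith [Real.exp_one_gt_d9]
      calc (1 / 3 : ℝ) ≤ (Real.exp 1)⁻¹ := by
            rw [one_div]
            exact inv_anti₀ (Real.exp_pos 1) (by linarith [Real.exp_one_lt_d9])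
        _ = Real.exp (-1) := (Real.exp_neg 1).symm
        _ ≤ _ := Real.exp_le_exp.2 (by nlinarith [Real.sqrt_nonneg (Real.log x)])
    have h2 := Chebyshev.theta_le_log4_mul_x hx0.le
    have h3 := Chebyshev.theta_nonneg x
    have h4 : Real.log 4 ≤ 2 := by
      rw [show (4 : ℝ) = 2 ^ 2 by norm_num, Real.log_pow]
      norm_num
      linarith [Real.log_two_lt_d9]
    have h5 : |Chebyshev.theta x - x| ≤ 2 * x := by
      rw [abs_le]; constructor <;> nlinarith
    calc _ ≤ 2 * x := h5
      _ ≤ 24 * x * (1 / 3) := by linarith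
      _ ≤ (C + 24) * x * Real.exp (-c * √(Real.log x)) := by gcongr; linarith

lemma primePi_eq_primeCounting {x : ℝ} (hx : 0 ≤ x) : primePi x = Nat.primeCounting ⌊x⌋₊ := by
  rw [primePi, ← Nat.primesLE_card_eq_primeCounting, ← Set.ncard_coe_finset]
  congr 1
  ext p
  simp [Nat.mem_primesLE, Nat.le_floor_iff hx, and_comm]

lemma li_eq {x : ℝ} (hx : 2 ≤ x) :
    li x = x / Real.log x - 2 / Real.log 2 + ∫ t in (2 : ℝ)..x, 1 / Real.log t ^ 2 := by
  have hlog : ∀ t ∈ uIcc 2 x, t ≠ 0 ∧ Real.log t ≠ 0 := by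
    intro t ht
    rw [uIcc_of_le hx] at ht
    exact ⟨by linarith [ht.1], (Real.log_pos (by linarith [ht.1])).ne'⟩
  have h := intervalIntegral.integral_mul_deriv_eq_deriv_mul (a := 2) (b := x)
    (u := fun t => (Real.log t)⁻¹) (v := fun t => t) (u' := fun t => -t⁻¹ / Real.log t ^ 2)
    (v' := fun _ => 1) (fun t ht => (Real.hasDerivAt_log (hlog t ht).1).inv (hlog t ht).2)
    (fun t _ => hasDerivAt_id t) ?_ (by simp)
  · simp only [mul_one] at h
    have e : ∫ t in (2 : ℝ)..x, -t⁻¹ / Real.log t ^ 2 * t =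
        -∫ t in (2 : ℝ)..x, 1 / Real.log t ^ 2 := by
      rw [← intervalIntegral.integral_neg]
      refine intervalIntegral.integral_congr fun t ht => ?_
      have := (hlog t ht).1
      have := (hlog t ht).2
      field_simp
    rw [li]
    simp only [one_div] at h e ⊢
    rw [h, e]
    ring
  · refine ContinuousOn.intervalIntegrable (ContinuousOn.div ?_ ?_ ?_)
    · exact (continuousOn_id.inv₀ fun t ht => (hlog t ht).1).neg
    · exact (Real.continuousOn_log.mono fun t ht => (hlog t ht).1).pow 2
    · exact fun t ht => pow_ne_zero 2 (hlog t ht).2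

lemma exp_neg_mul_sqrt_log_le {c t x : ℝ} (hc0 : 0 ≤ c) (hc : c ≤ 1) (ht : 0 < t)
    (htx : t ≤ x) : Real.exp (-c * √(Real.log t)) ≤
      3 * Real.exp (-c * √(Real.log x)) * (√x * t ^ (-(1 / 2) : ℝ)) := by
  have hx : 0 < x := ht.trans_le htx
  have h1 := sqrt_sub_sqrt_le (Real.log_le_log ht htx)
  set u := Real.log x - Real.log t with hu
  have hu0 : 0 ≤ u := sub_nonneg.2 (Real.log_le_log ht htx)
  have h2 : √u ≤ 1 + u / 2 := by
    nlinarith [Real.sq_sqrt hu0, sq_nonneg (√u - 1)]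
  have e : √x * t ^ (-(1 / 2) : ℝ) = Real.exp (u / 2) := by
    rw [Real.sqrt_eq_rpow, Real.rpow_def_of_pos hx, Real.rpow_def_of_pos ht, ← Real.exp_add]
    congr 1; rw [hu]; ring
  rw [e]
  calc Real.exp (-c * √(Real.log t)) ≤ Real.exp (1 + -c * √(Real.log x) + u / 2) := by
        refine Real.exp_le_exp.2 ?_
        have : c * √(Real.log x) ≤ c * (√(Real.log t) + √u) := by gcongr
        have : c * √u ≤ √u := mul_le_of_le_one_left (Real.sqrt_nonneg _) hc
        linarith
    _ = Real.exp 1 * Real.exp (-c * √(Real.log x)) * Real.exp (u / 2) := by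
        rw [Real.exp_add, Real.exp_add]
    _ ≤ _ := by
        gcongr
        linarith [Real.exp_one_lt_d9]

theorem prime_number_theorem_de_la_vallee_poussin :
    ∃ c : ℝ, 0 < c ∧ ∃ C : ℝ, 0 < C ∧ ∀ x : ℝ, 2 ≤ x →
      |(primePi x : ℝ) - li x| ≤ C * x * Real.exp (-c * Real.sqrt (Real.log x)) := by
  obtain ⟨c, hc, hc1, C, hC, h⟩ := exists_abs_theta_sub_le
  refine ⟨c, hc, 26 * C + 12, by positivity, fun x hx => ?_⟩
  have hx0 : 0 < x := by linarith
  have hlog2 : ∀ t : ℝ, 2 ≤ t → 1 / 2 ≤ Real.log t := fun t ht => by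
    have := Real.log_le_log two_pos ht
    linarith [Real.log_two_gt_d9]
  have hθi : IntervalIntegrable (fun t => Chebyshev.theta t / (t * Real.log t ^ 2)) volume 2 x :=
    (intervalIntegrable_iff_integrableOn_Icc_of_le hx).2
      (Chebyshev.integrableOn_theta_div_id_mul_log_sq x)
  have hli := Chebyshev.intervalIntegrable_one_div_log_sq (a := 2) (b := x) (by norm_num)
    (by linarith)
  set E : ℝ := Real.exp (-c * √(Real.log x)) with hE
  have hI : |∫ t in (2 : ℝ)..x, (Chebyshev.theta t / (t * Real.log t ^ 2) - 1 / Real.log t ^ 2)|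
      ≤ 24 * C * x * E := by
    have hr : IntervalIntegrable (fun t : ℝ => 12 * C * E * √x * t ^ (-(1 / 2) : ℝ)) volume 2 x :=
      (intervalIntegral.intervalIntegrable_rpow' (by norm_num)).const_mul _
    rw [← Real.norm_eq_abs]
    refine (intervalIntegral.norm_integral_le_of_norm_le hx ?_ hr).trans ?_
    · refine Eventually.of_forall fun t ht => ?_
      have ht2 : 2 ≤ t := ht.1.le
      have ht0 : 0 < t := by linarith
      have hl := hlog2 t ht2
      have e : Chebyshev.theta t / (t * Real.log t ^ 2) - 1 / Real.log t ^ 2 =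
          (Chebyshev.theta t - t) / (t * Real.log t ^ 2) := by field_simp
      rw [e, Real.norm_eq_abs, abs_div, abs_of_pos (by positivity : 0 < t * Real.log t ^ 2),
        div_le_iff₀ (by positivity)]
      have hl2 : (1 / 2 : ℝ) ^ 2 ≤ Real.log t ^ 2 := by gcongr
      calc |Chebyshev.theta t - t| ≤ C * t * Real.exp (-c * √(Real.log t)) := h t ht2
        _ ≤ C * t * (3 * E * (√x * t ^ (-(1 / 2) : ℝ))) := by
          gcongr
          exact exp_neg_mul_sqrt_log_le hc.le (by linarith) ht0 ht.2
        _ = 12 * C * E * √x * t ^ (-(1 / 2) : ℝ) * (t * (1 / 2) ^ 2) := by ring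
        _ ≤ _ := by gcongr
    · rw [intervalIntegral.integral_const_mul, integral_rpow (Or.inl (by norm_num))]
      have e : (-(1 / 2) + 1 : ℝ) = 1 / 2 := by norm_num
      rw [e, ← Real.sqrt_eq_rpow, ← Real.sqrt_eq_rpow]
      calc 12 * C * E * √x * ((√x - √2) / (1 / 2)) ≤ 12 * C * E * √x * (√x / (1 / 2)) := by
            gcongr
            linarith [Real.sqrt_nonneg 2]
        _ = 24 * C * (√x * √x) * E := by ring
        _ = _ := by rw [Real.mul_self_sqrt hx0.le]
  rw [intervalIntegral.integral_sub hθi hli] at hI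
  have h1 : |(Chebyshev.theta x - x) / Real.log x| ≤ 2 * C * x * E := by
    have hl := hlog2 x hx
    rw [abs_div, abs_of_pos (by linarith : 0 < Real.log x), div_le_iff₀ (by linarith)]
    calc _ ≤ C * x * E := h x hx
      _ = 2 * C * x * E * (1 / 2) := by ring
      _ ≤ _ := by gcongr
  have h2 : |2 / Real.log 2| ≤ 12 * x * E := by
    have hl := hlog2 2 le_rfl
    rw [abs_of_pos (by positivity), div_le_iff₀ (by linarith)]
    have h3 : 1 ≤ 3 * (x * E) := by
      have e : x * E = Real.exp (√(Real.log x) ^ 2 + -c * √(Real.log x)) := by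
        rw [Real.exp_add, Real.sq_sqrt (by linarith [hlog2 x hx]), Real.exp_log hx0]
      have h4 : Real.exp (-1) ≤ x * E := by
        rw [e]
        refine Real.exp_le_exp.2 ?_
        nlinarith [Real.sqrt_nonneg (Real.log x), sq_nonneg (√(Real.log x) - 1)]
      have h5 : Real.exp 1 * Real.exp (-1) = 1 := by rw [← Real.exp_add]; simp
      nlinarith [Real.exp_one_lt_d9, Real.exp_pos (-1)]
    nlinarith
  rw [primePi_eq_primeCounting hx0.le, Chebyshev.primeCounting_eq_theta_div_log_add_integral hx,
    li_eq hx]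
  have e : Chebyshev.theta x / Real.log x + (∫ t in (2 : ℝ)..x,
        Chebyshev.theta t / (t * Real.log t ^ 2)) - (x / Real.log x - 2 / Real.log 2 +
        ∫ t in (2 : ℝ)..x, 1 / Real.log t ^ 2) =
      (Chebyshev.theta x - x) / Real.log x + 2 / Real.log 2 +
        ((∫ t in (2 : ℝ)..x, Chebyshev.theta t / (t * Real.log t ^ 2)) -
        ∫ t in (2 : ℝ)..x, 1 / Real.log t ^ 2) := by ring
  rw [e]
  calc _ ≤ 2 * C * x * E + 12 * x * E + 24 * C * x * E :=
        (abs_add_le _ _).trans (add_le_add ((abs_add_le _ _).trans (add_le_add h1 h2)) hI)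
    _ = _ := by ring
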